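/- arXiv:cs/0512025 — 3 statements merged into one kernel-verified Lean document; each statement's English description precedes it below -/
import Mathlib

section
/- Let n ≥ 3, set α = (n−3)/2 and β = −1/2, and let k ≥ 1 and t ∈ (0,1). Define a_l = [(α+β+2)/(2l+α+β+2)]·√((l+α+1)(l+β+1)(l+1)(l+α+β+1) / ((2l+α+β+3)(2l+α+β+1))) and b_l = 2(α−β)·l·(l+α+β+1)/((2l+α+β)(2l+α+β+2)). Let S_k be the (k+1)×(k+1) symmetric tridiagonal matrix with diagonal entries b_0,…,b_k and off-diagonal entries a_0,…,a_{k−1}. Suppose λmax(S_{k−1}) ≥ (α+β+2)t² − β − 1 and λmax(S_k) < α+1. Then every finite set C of unit vectors in ℝ^n with |⟨x,y⟩| ≤ t for all distinct x, y ∈ C satisfies |C| ≤ [4(α+β+2)(k+α+1)/(2k+α+β+2)] · B(k+α, α)·B(k+α+β+1, k) / B(k+β, β) / (α + 1 − λmax(S_k)), where B(x,y) = Γ(x+1)/(Γ(y+1)·Γ(x−y+1)) denotes the generalized binomial coefficient. -/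
/-- Symmetric tridiagonal (k+1)×(k+1) matrix with diagonal `d 0, …, d k` and
off-diagonal `o 0, …, o (k-1)`. -/
noncomputable def Tridiag (k : ℕ) (d o : ℕ → ℝ) : Matrix (Fin (k + 1)) (Fin (k + 1)) ℝ :=
  Matrix.of fun i j =>
    if (i : ℕ) = (j : ℕ) then d i
    else if (i : ℕ) + 1 = (j : ℕ) then o i
    else if (j : ℕ) + 1 = (i : ℕ) then o j
    else 0

/-- The largest eigenvalue of a real square matrix. -/
noncomputable def maxEig {m : ℕ} (M : Matrix (Fin m) (Fin m) ℝ) : ℝ :=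
  sSup {μ : ℝ | Module.End.HasEigenvalue (Matrix.toLin' M) μ}
open RealInnerProductSpace

/-- The generalized binomial coefficient `B(x,y) = Γ(x+1)/(Γ(y+1)Γ(x−y+1))`. -/
noncomputable def genBinom (x y : ℝ) : ℝ :=
  Real.Gamma (x + 1) / (Real.Gamma (y + 1) * Real.Gamma (x - y + 1))

namespace ProjectiveCode
open MvPolynomial

section Zonal
variable {n : ℕ}

/-- The linear form `⟨x, ·⟩`. -/
noncomputable def lin (x : Fin n → ℝ) : MvPolynomial (Fin n) ℝ := ∑ i, C (x i) * X i

/-- The quadratic form `|·|²`. -/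
noncomputable def normSqPoly (n : ℕ) : MvPolynomial (Fin n) ℝ := ∑ i, X i ^ 2

/-- The Laplacian on polynomials. -/
noncomputable def laplacian (p : MvPolynomial (Fin n) ℝ) : MvPolynomial (Fin n) ℝ :=
  ∑ i, pderiv i (pderiv i p)

/-- The derivative in direction `x`. -/
noncomputable def dirDeriv (x : Fin n → ℝ) (p : MvPolynomial (Fin n) ℝ) :
    MvPolynomial (Fin n) ℝ :=
  ∑ i, C (x i) * pderiv i p

/-- Recurrence coefficients of the monic Gegenbauer polynomials. -/
noncomputable def gegenbauerCoeff (n m : ℕ) : ℝ :=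
  (m + 1) * (m + n - 2) / ((2 * m + n) * (2 * m + n - 2))

/-- The zonal harmonic with pole `x`, homogenized in both variables. -/
noncomputable def zonal (x : Fin n → ℝ) : ℕ → MvPolynomial (Fin n) ℝ
  | 0 => 1
  | 1 => lin x
  | m + 2 => lin x * zonal x (m + 1) -
      C (gegenbauerCoeff n m * ∑ i, x i ^ 2) * normSqPoly n * zonal x m

lemma pderiv_lin (x : Fin n → ℝ) (i : Fin n) : pderiv i (lin x) = C (x i) := by
  simp [lin, pderiv_X, Pi.single_apply]

lemma pderiv_normSqPoly (i : Fin n) : pderiv i (normSqPoly n) = 2 * X i := by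
  simp [normSqPoly, pderiv_X, Pi.single_apply, Derivation.leibniz_pow]

lemma dirDeriv_mul (x : Fin n → ℝ) (p q : MvPolynomial (Fin n) ℝ) :
    dirDeriv x (p * q) = p * dirDeriv x q + q * dirDeriv x p := by
  simp only [dirDeriv, Finset.mul_sum, ← Finset.sum_add_distrib]
  refine Finset.sum_congr rfl fun i _ => ?_
  rw [pderiv_mul]; ring

lemma dirDeriv_sub (x : Fin n → ℝ) (p q : MvPolynomial (Fin n) ℝ) :
    dirDeriv x (p - q) = dirDeriv x p - dirDeriv x q := by
  simp only [dirDeriv, map_sub, mul_sub, Finset.sum_sub_distrib]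

lemma dirDeriv_C (x : Fin n → ℝ) (a : ℝ) : dirDeriv x (C a) = 0 := by
  simp [dirDeriv]

lemma dirDeriv_lin (x : Fin n → ℝ) : dirDeriv x (lin x) = C (∑ i, x i ^ 2) := by
  simp [dirDeriv, pderiv_lin, sq]

lemma dirDeriv_normSqPoly (x : Fin n → ℝ) : dirDeriv x (normSqPoly n) = 2 * lin x := by
  simp only [dirDeriv, pderiv_normSqPoly, lin, Finset.mul_sum]
  exact Finset.sum_congr rfl fun i _ => by ring

lemma laplacian_sub (p q : MvPolynomial (Fin n) ℝ) :
    laplacian (p - q) = laplacian p - laplacian q := by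
  simp only [laplacian, map_sub, Finset.sum_sub_distrib]

lemma laplacian_C_mul (a : ℝ) (p : MvPolynomial (Fin n) ℝ) :
    laplacian (C a * p) = C a * laplacian p := by
  simp only [laplacian, pderiv_C_mul, Finset.mul_sum]

lemma laplacian_lin_mul (x : Fin n → ℝ) (p : MvPolynomial (Fin n) ℝ) :
    laplacian (lin x * p) = lin x * laplacian p + 2 * dirDeriv x p := by
  simp only [laplacian, dirDeriv, Finset.mul_sum, ← Finset.sum_add_distrib]
  refine Finset.sum_congr rfl fun i _ => ?_
  simp only [pderiv_mul, pderiv_lin, map_add, pderiv_C]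
  ring

lemma laplacian_normSqPoly_mul {m : ℕ} {p : MvPolynomial (Fin n) ℝ} (hp : p.IsHomogeneous m) :
    laplacian (normSqPoly n * p) = normSqPoly n * laplacian p + C (4 * m + 2 * n : ℝ) * p := by
  have h : ∀ i : Fin n, pderiv i (pderiv i (normSqPoly n * p)) =
      normSqPoly n * pderiv i (pderiv i p) + 4 * (X i * pderiv i p) + 2 * p := by
    intro i
    have h2 : pderiv i (2 : MvPolynomial (Fin n) ℝ) = 0 := by
      rw [show (2 : MvPolynomial (Fin n) ℝ) = C 2 from rfl, pderiv_C]
    simp only [pderiv_mul, pderiv_normSqPoly, map_add, pderiv_X_self, h2]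
    ring
  simp only [laplacian, h, Finset.sum_add_distrib, ← Finset.mul_sum, hp.sum_X_mul_pderiv]
  simp only [Finset.sum_const, Finset.card_univ, Fintype.card_fin, nsmul_eq_mul, map_add, map_mul,
    map_natCast, show (C 2 : MvPolynomial (Fin n) ℝ) = 2 from rfl,
    show (C 4 : MvPolynomial (Fin n) ℝ) = 4 from rfl]
  ring

lemma isHomogeneous_lin (x : Fin n → ℝ) : (lin x).IsHomogeneous 1 :=
  IsHomogeneous.sum _ _ _ fun _ _ => isHomogeneous_C_mul_X _ _

lemma isHomogeneous_normSqPoly : (normSqPoly n).IsHomogeneous 2 :=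
  IsHomogeneous.sum _ _ _ fun i _ => isHomogeneous_X_pow i 2

lemma isHomogeneous_zonal (x : Fin n → ℝ) (m : ℕ) : (zonal x m).IsHomogeneous m := by
  induction m using Nat.twoStepInduction with
  | zero => exact isHomogeneous_one _ _
  | one => exact isHomogeneous_lin x
  | more m h0 h1 =>
    rw [zonal]
    refine IsHomogeneous.sub ?_ ?_
    · exact (add_comm 1 (m + 1)) ▸ (isHomogeneous_lin x).mul h1
    · rw [mul_assoc]
      refine IsHomogeneous.C_mul ?_ _
      exact (add_comm 2 m) ▸ isHomogeneous_normSqPoly.mul h0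

/-- The factor in the directional derivative of a zonal harmonic towards its pole. -/
noncomputable def poleCoeff (n m : ℕ) : ℝ := (m + 1) * (m + n - 2) / (2 * m + n - 2)

lemma gegenbauerCoeff_eq (n m : ℕ) :
    gegenbauerCoeff n m = poleCoeff n m / (2 * m + n) := by
  rw [gegenbauerCoeff, poleCoeff, div_div, mul_comm (2 * (m : ℝ) + n)]

lemma poleCoeff_succ (hn : 3 ≤ n) (m : ℕ) :
    poleCoeff n (m + 1) = 1 + poleCoeff n m - 2 * gegenbauerCoeff n m := by
  have hn' : (3 : ℝ) ≤ n := by exact_mod_cast hn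
  have hm := m.cast_nonneg (α := ℝ)
  have e1 : (2 * (m : ℝ) + n - 2) ≠ 0 := by intro h; linarith
  have e2 : (2 * (m : ℝ) + n) ≠ 0 := by intro h; linarith
  have e3 : (2 * ((m + 1 : ℕ) : ℝ) + n - 2) = 2 * m + n := by push_cast; ring
  rw [poleCoeff, poleCoeff, gegenbauerCoeff, e3]
  field_simp
  push_cast
  ring

lemma poleCoeff_mul_gegenbauerCoeff (hn : 3 ≤ n) (m : ℕ) :
    (poleCoeff n (m + 1) - 2 * gegenbauerCoeff n (m + 1)) * gegenbauerCoeff n m =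
      gegenbauerCoeff n (m + 1) * poleCoeff n m := by
  have hn' : (3 : ℝ) ≤ n := by exact_mod_cast hn
  have hm := m.cast_nonneg (α := ℝ)
  have e2 : (2 * (m : ℝ) + n) ≠ 0 := by intro h; linarith
  have e3 : (2 * ((m + 1 : ℕ) : ℝ) + n) ≠ 0 := by push_cast; intro h; linarith
  rw [gegenbauerCoeff_eq, gegenbauerCoeff_eq]
  field_simp
  push_cast
  ring

lemma dirDeriv_zonal (hn : 3 ≤ n) (x : Fin n → ℝ) (m : ℕ) :
    dirDeriv x (zonal x (m + 1)) =
      C (poleCoeff n m) * C (∑ i, x i ^ 2) * zonal x m := by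
  have hn' : (3 : ℝ) ≤ n := by exact_mod_cast hn
  have step : ∀ m, dirDeriv x (zonal x (m + 2)) =
      C (∑ i, x i ^ 2) * zonal x (m + 1) + lin x * dirDeriv x (zonal x (m + 1)) -
      C (gegenbauerCoeff n m) * C (∑ i, x i ^ 2) *
        (2 * lin x * zonal x m + normSqPoly n * dirDeriv x (zonal x m)) := by
    intro m
    rw [zonal, dirDeriv_sub, dirDeriv_mul, dirDeriv_lin, mul_assoc, dirDeriv_mul, dirDeriv_C,
      dirDeriv_mul, dirDeriv_normSqPoly, C_mul]
    ring
  have hC : ∀ m, (C (poleCoeff n (m + 1)) : MvPolynomial (Fin n) ℝ) =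
      1 + C (poleCoeff n m) - 2 * C (gegenbauerCoeff n m) := by
    intro m
    rw [poleCoeff_succ hn, C_sub, C_add, C_mul, C_1]; rfl
  have hC' : ∀ m, (C (poleCoeff n (m + 1)) - 2 * C (gegenbauerCoeff n (m + 1))) *
      C (gegenbauerCoeff n m) =
      (C (gegenbauerCoeff n (m + 1)) * C (poleCoeff n m) : MvPolynomial (Fin n) ℝ) := by
    intro m
    rw [← C_mul, ← poleCoeff_mul_gegenbauerCoeff hn, C_mul, C_sub, C_mul]; rfl
  induction m using Nat.twoStepInduction with
  | zero =>
    have : poleCoeff n 0 = 1 := by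
      have : (n : ℝ) - 2 ≠ 0 := by linarith
      simp [poleCoeff, this]
    simp [zonal, dirDeriv_lin, this]
  | one =>
    have h1 : dirDeriv x (zonal x 1) = C (∑ i, x i ^ 2) := dirDeriv_lin x
    have h0 : dirDeriv x (zonal x 0) = 0 := by rw [zonal, ← C_1, dirDeriv_C]
    have h2 : (C (poleCoeff n 0) : MvPolynomial (Fin n) ℝ) = 1 := by
      have : (n : ℝ) - 2 ≠ 0 := by linarith
      simp [poleCoeff, this]
    rw [step, h1, h0, hC, h2]
    simp only [zonal]
    ring
  | more m h0 h1 =>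
    rw [step, h1, h0]
    have hz : zonal x (m + 2) = lin x * zonal x (m + 1) -
      C (gegenbauerCoeff n m) * C (∑ i, x i ^ 2) * normSqPoly n * zonal x m := by
      rw [zonal, C_mul]
    linear_combination (C (poleCoeff n (m + 1)) - 2 * C (gegenbauerCoeff n (m + 1))) *
      C (∑ i, x i ^ 2) * (-hz) - C (∑ i, x i ^ 2) * zonal x (m + 2) * hC (m + 1) +
      C (∑ i, x i ^ 2) ^ 2 * normSqPoly n * zonal x m * hC' m

lemma laplacian_zonal (hn : 3 ≤ n) (x : Fin n → ℝ) (m : ℕ) : laplacian (zonal x m) = 0 := by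
  have hn' : (3 : ℝ) ≤ n := by exact_mod_cast hn
  induction m using Nat.twoStepInduction with
  | zero => simp [zonal, laplacian]
  | one => simp [zonal, laplacian, pderiv_lin]
  | more m h0 h1 =>
    have hm := m.cast_nonneg (α := ℝ)
    have e2 : (2 * (m : ℝ) + n) ≠ 0 := by intro h; linarith
    have h : gegenbauerCoeff n m * (4 * m + 2 * n) = 2 * poleCoeff n m := by
      rw [gegenbauerCoeff_eq]
      field_simp
      ring
    have hC : C (gegenbauerCoeff n m) * C (4 * m + 2 * n : ℝ) =
        (2 * C (poleCoeff n m) : MvPolynomial (Fin n) ℝ) := by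
      rw [← C_mul, h, C_mul]; rfl
    rw [zonal, laplacian_sub, laplacian_lin_mul, mul_assoc, laplacian_C_mul,
      laplacian_normSqPoly_mul (isHomogeneous_zonal x m), h0, h1, dirDeriv_zonal hn, C_mul]
    linear_combination (-C (∑ i, x i ^ 2) * zonal x m) * hC

lemma eval_lin (x y : Fin n → ℝ) : eval y (lin x) = ∑ i, x i * y i := by simp [lin]

lemma eval_normSqPoly (y : Fin n → ℝ) : eval y (normSqPoly n) = ∑ i, y i ^ 2 := by
  simp [normSqPoly]

lemma eval_zonal_comm (x y : Fin n → ℝ) (m : ℕ) :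
    eval y (zonal x m) = eval x (zonal y m) := by
  have hl : eval y (lin x) = eval x (lin y) := by simp only [eval_lin, mul_comm]
  induction m using Nat.twoStepInduction with
  | zero => simp [zonal]
  | one => exact hl
  | more m h0 h1 =>
    simp only [zonal, map_sub, map_mul, eval_C, h0, h1, hl, eval_normSqPoly]
    ring

lemma exists_coeff_zonal (m : ℕ) (d : Fin n →₀ ℕ) :
    ∃ φ : MvPolynomial (Fin n) ℝ, ∀ x, eval x φ = coeff d (zonal x m) := by
  induction m using Nat.twoStepInduction generalizing d with
  | zero => exact ⟨C (coeff d 1), fun x => by simp [zonal]⟩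
  | one =>
    refine ⟨∑ i, X i * C (coeff d (X i)), fun x => ?_⟩
    simp [zonal, lin, coeff_sum]
  | more m h0 h1 =>
    choose φ hφ using h0
    choose ψ hψ using h1
    refine ⟨(∑ i, X i * if i ∈ d.support then ψ (d - Finsupp.single i 1) else 0) -
      C (gegenbauerCoeff n m) * normSqPoly n * ∑ e ∈ Finset.HasAntidiagonal.antidiagonal d,
        C (coeff e.1 (normSqPoly n)) * φ e.2, fun x => ?_⟩
    rw [zonal, coeff_sub, mul_assoc (C (_ * _)), coeff_C_mul, coeff_mul (normSqPoly n), lin,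
      Finset.sum_mul, coeff_sum, map_sub, map_mul, map_mul, eval_C, eval_normSqPoly, map_sum, map_sum]
    congr 1
    · refine Finset.sum_congr rfl fun i _ => ?_
      rw [mul_assoc, coeff_C_mul, coeff_X_mul']
      split_ifs <;> simp [hψ]
    · simp [hφ]

end Zonal

section Fischer
variable {n : ℕ}

/-- The Fischer pairing of polynomials, as a linear functional of the first argument. -/
noncomputable def fischer (q : MvPolynomial (Fin n) ℝ) : MvPolynomial (Fin n) ℝ →ₗ[ℝ] ℝ :=
  (basisMonomials (Fin n) ℝ).constr ℝ fun d => (∏ i, ((d i).factorial : ℝ)) * coeff d q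

lemma fischer_monomial (q : MvPolynomial (Fin n) ℝ) (d : Fin n →₀ ℕ) (c : ℝ) :
    fischer q (monomial d c) = c * ((∏ i, ((d i).factorial : ℝ)) * coeff d q) := by
  have h : monomial d c = c • basisMonomials (Fin n) ℝ d := by
    simp [smul_monomial]
  rw [h, map_smul, fischer, Module.Basis.constr_basis, smul_eq_mul]

lemma prod_factorial_add_single (d : Fin n →₀ ℕ) (i : Fin n) :
    (∏ j, (((d + Finsupp.single i 1 : Fin n →₀ ℕ) j).factorial : ℝ)) =
      (d i + 1) * ∏ j, ((d j).factorial : ℝ) := by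
  classical
  rw [← Finset.mul_prod_erase _ _ (Finset.mem_univ i),
    ← Finset.mul_prod_erase _ (fun j => ((d j).factorial : ℝ)) (Finset.mem_univ i), ← mul_assoc]
  congr 1
  · simp [Nat.factorial_succ]
  · refine Finset.prod_congr rfl fun j hj => ?_
    simp [(Finset.ne_of_mem_erase hj).symm]

lemma fischer_X_mul (q p : MvPolynomial (Fin n) ℝ) (i : Fin n) :
    fischer q (X i * p) = fischer (pderiv i q) p := by
  induction p using MvPolynomial.induction_on' with
  | monomial d c =>
    have h : X i * monomial d c = monomial (d + Finsupp.single i 1) c := by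
      rw [X, monomial_mul, one_mul, add_comm]
    rw [h, fischer_monomial, fischer_monomial, coeff_pderiv, prod_factorial_add_single]
    ring
  | add p q hp hq => rw [mul_add, map_add, map_add, hp, hq]

lemma fischer_normSqPoly_mul (q p : MvPolynomial (Fin n) ℝ) :
    fischer q (normSqPoly n * p) = fischer (laplacian q) p := by
  have h : fischer (laplacian q) p = ∑ i, fischer (pderiv i (pderiv i q)) p := by
    induction p using MvPolynomial.induction_on' with
    | monomial d c =>
      simp only [fischer_monomial, laplacian, coeff_sum, Finset.mul_sum]
    | add p q hp hq => simp only [map_add, hp, hq, Finset.sum_add_distrib]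
  rw [h, normSqPoly, Finset.sum_mul, map_sum]
  refine Finset.sum_congr rfl fun i _ => ?_
  rw [sq, mul_assoc, fischer_X_mul, fischer_X_mul]

lemma fischer_lin_pow (x : Fin n → ℝ) (m : ℕ) (q : MvPolynomial (Fin n) ℝ)
    (hq : q.IsHomogeneous m) : fischer q (lin x ^ m) = m.factorial * eval x q := by
  induction m generalizing q with
  | zero =>
    obtain ⟨c, rfl⟩ : ∃ c, q = C c :=
      ⟨_, (totalDegree_eq_zero_iff_eq_C).1 ((totalDegree_zero_iff_isHomogeneous _).2 hq)⟩
    have : (1 : MvPolynomial (Fin n) ℝ) = monomial 0 1 := rfl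
    rw [pow_zero, this, fischer_monomial]
    simp
  | succ m ih =>
    have h : ∀ i, fischer q (C (x i) * X i * lin x ^ m) =
        x i * (m.factorial * eval x (pderiv i q)) := by
      intro i
      rw [mul_assoc, ← smul_eq_C_mul, map_smul, fischer_X_mul, ih _ hq.pderiv, smul_eq_mul]
    have hE := congrArg (eval x) hq.sum_X_mul_pderiv
    simp only [map_sum, map_mul, eval_X, nsmul_eq_mul, map_natCast] at hE
    rw [pow_succ', lin, Finset.sum_mul, map_sum, ← lin, Finset.sum_congr rfl fun i _ => h i,
      Nat.factorial_succ, Nat.cast_mul, mul_comm ((m + 1 : ℕ) : ℝ), mul_assoc, ← hE,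
      Finset.mul_sum]
    exact Finset.sum_congr rfl fun i _ => by ring

lemma fischer_zonal (hn : 3 ≤ n) (x y : Fin n → ℝ) (m : ℕ) :
    fischer (zonal y m) (zonal x m) = m.factorial * eval x (zonal y m) := by
  have h : ∀ m, ∃ p, zonal x m = lin x ^ m + normSqPoly n * p := by
    intro m
    induction m using Nat.twoStepInduction with
    | zero => exact ⟨0, by simp [zonal]⟩
    | one => exact ⟨0, by simp [zonal]⟩
    | more m h0 h1 =>
      obtain ⟨p, hp⟩ := h1
      refine ⟨lin x * p - C (gegenbauerCoeff n m * ∑ i, x i ^ 2) * zonal x m, ?_⟩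
      rw [zonal, hp]
      ring
  obtain ⟨p, hp⟩ := h m
  have h0 : fischer (0 : MvPolynomial (Fin n) ℝ) p = 0 := by
    clear hp
    induction p using MvPolynomial.induction_on' with
    | monomial d c => simp [fischer_monomial]
    | add p q hp hq => rw [map_add, hp, hq, add_zero]
  rw [hp, map_add, fischer_normSqPoly_mul, laplacian_zonal hn, h0, add_zero,
    fischer_lin_pow _ _ _ (isHomogeneous_zonal y m)]

/-- Zonal harmonics are positive definite kernels with polynomial features. -/
lemma exists_features_zonal (hn : 3 ≤ n) (m : ℕ) :
    ∃ (s : Finset (Fin n →₀ ℕ)) (φ : (Fin n →₀ ℕ) → MvPolynomial (Fin n) ℝ), ∀ x y,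
      eval y (zonal x m) = ∑ d ∈ s, eval x (φ d) * eval y (φ d) := by
  choose ψ hψ using fun d => exists_coeff_zonal (n := n) m d
  refine ⟨Finset.finsuppAntidiag Finset.univ m,
    fun d => C (√((∏ i, ((d i).factorial : ℝ)) / m.factorial)) * ψ d, fun x y => ?_⟩
  have hs : (zonal x m).support ⊆ Finset.finsuppAntidiag Finset.univ m := by
    intro d hd
    rw [Finset.mem_finsuppAntidiag]
    refine ⟨?_, Finset.subset_univ _⟩
    have := (isHomogeneous_zonal x m).degree_eq_sum_deg_support hd
    rw [this, Finset.sum_subset (Finset.subset_univ d.support)]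
    simp
  have h1 : fischer (zonal y m) (zonal x m) = ∑ d ∈ Finset.finsuppAntidiag Finset.univ m,
      coeff d (zonal x m) * ((∏ i, ((d i).factorial : ℝ)) * coeff d (zonal y m)) := by
    conv_lhs => rw [(zonal x m).as_sum, map_sum]
    simp only [fischer_monomial]
    refine Finset.sum_subset hs fun d _ hd => ?_
    rw [notMem_support_iff.1 hd, zero_mul]
  rw [fischer_zonal hn] at h1
  have h2 : (m.factorial : ℝ) ≠ 0 := by positivity
  rw [eval_zonal_comm, ← mul_right_inj' h2, h1, Finset.mul_sum]
  refine Finset.sum_congr rfl fun d _ => ?_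
  have h3 := Real.mul_self_sqrt
    (show 0 ≤ (∏ i, ((d i).factorial : ℝ)) / m.factorial by positivity)
  simp only [map_mul, eval_C, hψ]
  have h4 : (m.factorial : ℝ) * (√((∏ i, ((d i).factorial : ℝ)) / m.factorial) *
      √((∏ i, ((d i).factorial : ℝ)) / m.factorial)) = ∏ i, ((d i).factorial : ℝ) := by
    rw [h3]; field_simp
  linear_combination (-(coeff d (zonal x m) * coeff d (zonal y m))) * h4

end Fischer

section Mean
variable {n : ℕ}

/-- The moments of a standard Gaussian variable. -/
noncomputable def gaussianMoment : ℕ → ℝ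
  | 0 => 1
  | 1 => 0
  | m + 2 => (m + 1) * gaussianMoment m

/-- The normalization relating Gaussian and spherical moments in degree `m`. -/
noncomputable def radialMoment (n : ℕ) : ℕ → ℝ
  | 0 => 1
  | 1 => 1
  | m + 2 => (n + m) * radialMoment n m

/-- The mean of the monomial with exponent `d` over the unit sphere. -/
noncomputable def monomialMean (d : Fin n →₀ ℕ) : ℝ :=
  (∏ i, gaussianMoment (d i)) / radialMoment n d.degree

/-- The mean of a polynomial over the unit sphere, defined algebraically. -/
noncomputable def sphereMean (n : ℕ) : MvPolynomial (Fin n) ℝ →ₗ[ℝ] ℝ :=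
  (basisMonomials (Fin n) ℝ).constr ℝ monomialMean

lemma sphereMean_monomial (d : Fin n →₀ ℕ) (c : ℝ) :
    sphereMean n (monomial d c) = c * monomialMean d := by
  have h : monomial d c = c • basisMonomials (Fin n) ℝ d := by
    simp [smul_monomial]
  rw [h, map_smul, sphereMean, Module.Basis.constr_basis, smul_eq_mul]

lemma sphereMean_one : sphereMean n 1 = 1 := by
  have : (1 : MvPolynomial (Fin n) ℝ) = monomial 0 1 := rfl
  rw [this, sphereMean_monomial]
  simp [monomialMean, gaussianMoment, radialMoment]

lemma monomialMean_add_single (hn : 3 ≤ n) (d : Fin n →₀ ℕ) (i : Fin n) :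
    (n + d.degree) * monomialMean (d + Finsupp.single i 2) = (d i + 1) * monomialMean d := by
  have hn' : (3 : ℝ) ≤ n := by exact_mod_cast hn
  have h1 : (∏ j, gaussianMoment ((d + Finsupp.single i 2 : Fin n →₀ ℕ) j)) =
      (d i + 1) * ∏ j, gaussianMoment (d j) := by
    rw [← Finset.mul_prod_erase _ _ (Finset.mem_univ i),
      ← Finset.mul_prod_erase _ (fun j => gaussianMoment (d j)) (Finset.mem_univ i), ← mul_assoc]
    congr 1
    · simp [gaussianMoment]
    · refine Finset.prod_congr rfl fun j hj => ?_
      simp [(Finset.ne_of_mem_erase hj).symm]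
  have h2 : (d + Finsupp.single i 2).degree = d.degree + 2 := by simp
  have h3 : (n + d.degree : ℝ) ≠ 0 := by positivity
  rw [monomialMean, monomialMean, h1, h2, radialMoment, mul_div_assoc', mul_div_assoc',
    mul_div_mul_left _ _ h3]

lemma sphereMean_normSqPoly_mul (hn : 3 ≤ n) (p : MvPolynomial (Fin n) ℝ) :
    sphereMean n (normSqPoly n * p) = sphereMean n p := by
  have hn' : (3 : ℝ) ≤ n := by exact_mod_cast hn
  induction p using MvPolynomial.induction_on' with
  | monomial d c =>
    have h : ∀ i : Fin n, X i ^ 2 * monomial d c = monomial (d + Finsupp.single i 2) c := by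
      intro i
      rw [X_pow_eq_monomial, monomial_mul, one_mul, add_comm]
    have h3 : (n + d.degree : ℝ) ≠ 0 := by positivity
    have h4 : ∀ i : Fin n, sphereMean n (X i ^ 2 * monomial d c) =
        c * monomialMean d / (n + d.degree) * (d i + 1) := by
      intro i
      rw [h, sphereMean_monomial, eq_comm, div_mul_eq_mul_div, div_eq_iff h3]
      linear_combination (-c) * monomialMean_add_single hn d i
    have h5 : ∑ i, ((d i : ℝ) + 1) = n + d.degree := by
      rw [Finset.sum_add_distrib, Finsupp.degree_eq_sum]
      simp [add_comm]
    rw [normSqPoly, Finset.sum_mul, map_sum, Finset.sum_congr rfl fun i _ => h4 i,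
      ← Finset.mul_sum, h5, div_mul_cancel₀ _ h3, sphereMean_monomial]
  | add p q hp hq => rw [mul_add, map_add, map_add, hp, hq]

lemma sphereMean_normSqPoly_pow_mul (hn : 3 ≤ n) (m : ℕ) (p : MvPolynomial (Fin n) ℝ) :
    sphereMean n (normSqPoly n ^ m * p) = sphereMean n p := by
  induction m with
  | zero => simp
  | succ m ih => rw [pow_succ', mul_assoc, sphereMean_normSqPoly_mul hn, ih]

lemma sphereMean_laplacian_monomial (hn : 3 ≤ n) (d : Fin n →₀ ℕ) (c : ℝ) :
    sphereMean n (laplacian (monomial d c)) =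
      d.degree * (d.degree + n - 2) * sphereMean n (monomial d c) := by
  have h : ∀ i : Fin n, sphereMean n (pderiv i (pderiv i (monomial d c))) =
      c * (d.degree + n - 2) * monomialMean d * d i := by
    intro i
    rw [pderiv_monomial, pderiv_monomial, sphereMean_monomial]
    match hi : d i with
    | 0 => simp
    | 1 =>
      have : monomialMean d = 0 := by
        rw [monomialMean, Finset.prod_eq_zero (Finset.mem_univ i), zero_div]
        rw [hi]; rfl
      simp [hi, this]
    | e + 2 =>
      obtain ⟨d', rfl⟩ : ∃ d', d = d' + Finsupp.single i 2 :=
        ⟨d - Finsupp.single i 2, (tsub_add_cancel_of_le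
          (Finsupp.single_le_iff.2 (by omega))).symm⟩
      have h1 : d' i = e := by simpa using hi
      have h2 : d' + Finsupp.single i 2 - Finsupp.single i 1 - Finsupp.single i 1 = d' := by
        ext j
        by_cases hj : i = j <;> simp [hj]
      have h3 := monomialMean_add_single hn d' i
      rw [h2]
      have h4 : (((d' + Finsupp.single i 2).degree : ℕ) : ℝ) = d'.degree + 2 := by simp
      rw [h4]
      simp [h1] at h3 ⊢
      linear_combination (-c * (e + 2)) * h3
  rw [laplacian, map_sum, Finset.sum_congr rfl fun i _ => h i, ← Finset.mul_sum,
    sphereMean_monomial]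
  have h5 : ∑ i, (d i : ℝ) = d.degree := by
    rw [Finsupp.degree_eq_sum]; simp
  rw [h5]
  ring

lemma sphereMean_eq_zero (hn : 3 ≤ n) {m : ℕ} (hm : 0 < m) {p : MvPolynomial (Fin n) ℝ}
    (hp : p.IsHomogeneous m) (hl : laplacian p = 0) : sphereMean n p = 0 := by
  have hn' : (3 : ℝ) ≤ n := by exact_mod_cast hn
  have hm' : (1 : ℝ) ≤ m := by exact_mod_cast hm
  have h : sphereMean n (laplacian p) = m * (m + n - 2) * sphereMean n p := by
    have hL : laplacian p = ∑ d ∈ p.support, laplacian (monomial d (coeff d p)) := by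
      conv_lhs => rw [p.as_sum]
      simp only [laplacian, map_sum]
      exact Finset.sum_comm
    conv_rhs => rw [p.as_sum]
    rw [hL, map_sum, map_sum, Finset.mul_sum]
    refine Finset.sum_congr rfl fun d hd => ?_
    have : d.degree = m := by
      by_contra hne
      exact mem_support_iff.1 hd (hp.coeff_eq_zero hne)
    rw [sphereMean_laplacian_monomial hn, this]
  rw [hl, map_zero] at h
  have : (m : ℝ) * (m + n - 2) ≠ 0 := mul_ne_zero (by linarith) (by linarith)
  simpa [this] using h.symm

/-- A kernel with polynomial features whose mean in one variable is constant
dominates that constant. -/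
lemma card_sq_le_sum_kernel {σ ι κ : Type*} (T : MvPolynomial σ ℝ →ₗ[ℝ] ℝ)
    (S : Finset κ) (ψ : κ → MvPolynomial σ ℝ) (K : (σ → ℝ) → MvPolynomial σ ℝ)
    (P : MvPolynomial σ ℝ) (hK : ∀ x y, eval y (K x) = ∑ p ∈ S, eval x (ψ p) * eval y (ψ p))
    (hT : ∀ x, T (K x) = eval x P) (hP : T P = 1) (C : Finset ι) (v : ι → σ → ℝ)
    (hv : ∀ i ∈ C, eval (v i) P = 1) :
    (C.card : ℝ) ^ 2 ≤ ∑ i ∈ C, ∑ j ∈ C, eval (v j) (K (v i)) := by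
  have h1 : ∀ x, K x = ∑ p ∈ S, eval x (ψ p) • ψ p := by
    intro x
    refine MvPolynomial.funext fun y => ?_
    simp [hK, smul_eval]
  have h2 : ∀ x, ∑ p ∈ S, eval x (ψ p) * T (ψ p) = eval x P := by
    intro x
    rw [← hT, h1, map_sum]
    simp
  have h3 : P = ∑ p ∈ S, T (ψ p) • ψ p := by
    refine MvPolynomial.funext fun y => ?_
    simp [← h2, smul_eval, mul_comm]
  have h4 : ∑ p ∈ S, T (ψ p) ^ 2 = 1 := by
    rw [← hP]
    conv_rhs => rw [h3, map_sum]
    simp [sq]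
  have h5 : 0 ≤ ∑ p ∈ S, (∑ i ∈ C, eval (v i) (ψ p) - C.card * T (ψ p)) ^ 2 :=
    Finset.sum_nonneg fun _ _ => sq_nonneg _
  have h6 : ∑ p ∈ S, (∑ i ∈ C, eval (v i) (ψ p)) ^ 2 =
      ∑ i ∈ C, ∑ j ∈ C, eval (v j) (K (v i)) := by
    simp only [hK, sq, Finset.sum_mul_sum]
    rw [Finset.sum_comm]
    exact Finset.sum_congr rfl fun i _ => Finset.sum_comm
  have h7 : ∑ p ∈ S, (∑ i ∈ C, eval (v i) (ψ p)) * T (ψ p) = C.card := by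
    simp only [Finset.sum_mul]
    rw [Finset.sum_comm, Finset.sum_congr rfl fun i hi => (h2 (v i)).trans (hv i hi)]
    simp
  have h8 : ∑ p ∈ S, (∑ i ∈ C, eval (v i) (ψ p) - C.card * T (ψ p)) ^ 2 =
      ∑ p ∈ S, (∑ i ∈ C, eval (v i) (ψ p)) ^ 2 -
      2 * C.card * ∑ p ∈ S, (∑ i ∈ C, eval (v i) (ψ p)) * T (ψ p) +
      C.card ^ 2 * ∑ p ∈ S, T (ψ p) ^ 2 := by
    rw [Finset.mul_sum, Finset.mul_sum, ← Finset.sum_sub_distrib, ← Finset.sum_add_distrib]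
    exact Finset.sum_congr rfl fun _ _ => by ring
  rw [h8, h6, h7, h4] at h5
  linarith

end Mean

section Orthonormal
variable {n : ℕ}

/-- The normalization turning even zonal harmonics into orthonormal polynomials. -/
noncomputable def normFactor (n : ℕ) (a : ℕ → ℝ) : ℕ → ℝ
  | 0 => 1
  | l + 1 => n / 2 * normFactor n a l / a l

/-- The orthonormal projective zonal polynomials with pole `x`. -/
noncomputable def projZonal (a : ℕ → ℝ) (x : Fin n → ℝ) (l : ℕ) : MvPolynomial (Fin n) ℝ :=
  C (normFactor n a l) * zonal x (2 * l)

/-- The Jacobi coefficients of the projective space in dimension `n`. -/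
structure IsProjJacobi (n : ℕ) (a b : ℕ → ℝ) : Prop where
  pos : ∀ l, 0 < a l
  sq_eq : ∀ l, a l ^ 2 =
    (n / 2) ^ 2 * gegenbauerCoeff n (2 * l) * gegenbauerCoeff n (2 * l + 1)
  zero_eq : b 0 = n / 2 * gegenbauerCoeff n 0 - 1 / 2
  succ_eq : ∀ l, b (l + 1) =
    n / 2 * (gegenbauerCoeff n (2 * l + 1) + gegenbauerCoeff n (2 * l + 2)) - 1 / 2

variable {a b : ℕ → ℝ}

lemma normFactor_pos (hn : 3 ≤ n) (h : IsProjJacobi n a b) (l : ℕ) : 0 < normFactor n a l := by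
  induction l with
  | zero => simp [normFactor]
  | succ l ih =>
    have := h.pos l
    rw [normFactor]; positivity

lemma mul_normFactor_succ (h : IsProjJacobi n a b) (l : ℕ) :
    a l * normFactor n a (l + 1) = n / 2 * normFactor n a l := by
  have := (h.pos l).ne'
  rw [normFactor]; field_simp

/-- The homogenization of `P₁`. -/
noncomputable def multiplier (x : Fin n → ℝ) : MvPolynomial (Fin n) ℝ :=
  C (n / 2 : ℝ) * lin x ^ 2 - C (1 / 2 : ℝ) * C (∑ i, x i ^ 2) * normSqPoly n

lemma zonal_add_two (x : Fin n → ℝ) (m : ℕ) : zonal x (m + 2) = lin x * zonal x (m + 1) -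
    C (gegenbauerCoeff n m) * C (∑ i, x i ^ 2) * normSqPoly n * zonal x m := by
  rw [zonal, C_mul]

lemma multiplier_mul_projZonal_zero (h : IsProjJacobi n a b) (x : Fin n → ℝ) :
    multiplier x * projZonal a x 0 = C (a 0) * projZonal a x 1 +
      C (b 0) * C (∑ i, x i ^ 2) * normSqPoly n * projZonal a x 0 := by
  have h1 := zonal_add_two x 0
  rw [show zonal x (0 + 1) = lin x from rfl, show zonal x 0 = 1 from rfl] at h1
  have h2 : (C (a 0) * C (normFactor n a 1) : MvPolynomial (Fin n) ℝ) =
      C (n / 2 : ℝ) * C (normFactor n a 0) := by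
    rw [← C_mul, mul_normFactor_succ h, C_mul]
  have h3 : (C (b 0) : MvPolynomial (Fin n) ℝ) =
      C (n / 2 : ℝ) * C (gegenbauerCoeff n 0) - C (1 / 2 : ℝ) := by
    rw [h.zero_eq, C_sub, C_mul]
  rw [projZonal, projZonal, multiplier, show zonal x (2 * 0) = 1 from rfl,
    show zonal x (2 * 1) = zonal x (0 + 2) from rfl]
  linear_combination (-(C (n / 2 : ℝ) * C (normFactor n a 0))) * h1 - zonal x (0 + 2) * h2 -
    C (∑ i, x i ^ 2) * normSqPoly n * C (normFactor n a 0) * h3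

lemma multiplier_mul_projZonal_succ (h : IsProjJacobi n a b) (x : Fin n → ℝ) (l : ℕ) :
    multiplier x * projZonal a x (l + 1) = C (a (l + 1)) * projZonal a x (l + 2) +
      C (b (l + 1)) * C (∑ i, x i ^ 2) * normSqPoly n * projZonal a x (l + 1) +
      C (a l) * C (∑ i, x i ^ 2) ^ 2 * normSqPoly n ^ 2 * projZonal a x l := by
  have h1 := zonal_add_two x (2 * l)
  have h1' := zonal_add_two x (2 * l + 1)
  have h1'' := zonal_add_two x (2 * l + 2)
  have h2 : (C (a (l + 1)) * C (normFactor n a (l + 2)) : MvPolynomial (Fin n) ℝ) =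
      C (n / 2 : ℝ) * C (normFactor n a (l + 1)) := by
    rw [← C_mul, mul_normFactor_succ h, C_mul]
  have h2' : (C (a l) * C (normFactor n a l) : MvPolynomial (Fin n) ℝ) =
      C (n / 2 : ℝ) * C (gegenbauerCoeff n (2 * l)) * C (gegenbauerCoeff n (2 * l + 1)) *
        C (normFactor n a (l + 1)) := by
    simp only [← C_mul]
    congr 1
    have hn : (n / 2 : ℝ) ≠ 0 := by
      intro h0
      have := h.sq_eq 0
      rw [h0] at this
      have := h.pos 0
      simp_all
    refine mul_left_cancel₀ hn ?_
    linear_combination (-a l) * mul_normFactor_succ h l + normFactor n a (l + 1) * h.sq_eq l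
  have h3 : (C (b (l + 1)) : MvPolynomial (Fin n) ℝ) =
      C (n / 2 : ℝ) * (C (gegenbauerCoeff n (2 * l + 1)) + C (gegenbauerCoeff n (2 * l + 2))) -
      C (1 / 2 : ℝ) := by
    rw [h.succ_eq, C_sub, C_mul, C_add]
  simp only [projZonal, multiplier, show 2 * (l + 1) = 2 * l + 2 by ring,
    show 2 * (l + 2) = 2 * l + 4 by ring]
  rw [show 2 * l + 2 + 2 = 2 * l + 4 by ring, show 2 * l + 2 + 1 = 2 * l + 3 by ring] at h1''
  rw [show 2 * l + 1 + 2 = 2 * l + 3 by ring, show 2 * l + 1 + 1 = 2 * l + 2 by ring] at h1'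
  set N := C (n / 2 : ℝ)
  set k := (C (normFactor n a (l + 1)) : MvPolynomial (Fin n) ℝ)
  set r := (C (∑ i, x i ^ 2) : MvPolynomial (Fin n) ℝ)
  linear_combination (-zonal x (2 * l + 4)) * h2 - r ^ 2 * normSqPoly n ^ 2 * zonal x (2 * l) * h2'
    - r * normSqPoly n * zonal x (2 * l + 2) * k * h3 - N * k * h1'' - N * k * lin x * h1' -
    N * k * C (gegenbauerCoeff n (2 * l + 1)) * r * normSqPoly n * h1

lemma sphereMean_projZonal (hn : 3 ≤ n) (x : Fin n → ℝ) {l : ℕ} (hl : 0 < l) :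
    sphereMean n (projZonal a x l) = 0 := by
  rw [projZonal, ← smul_eq_C_mul, map_smul, sphereMean_eq_zero hn (m := 2 * l) (by omega)
    (isHomogeneous_zonal x _) (laplacian_zonal hn x _), smul_zero]

lemma sphereMean_C_mul (c : ℝ) (p : MvPolynomial (Fin n) ℝ) :
    sphereMean n (C c * p) = c * sphereMean n p := by
  rw [← smul_eq_C_mul, map_smul, smul_eq_mul]

lemma sphereMean_multiplier_zero (hn : 3 ≤ n) (h : IsProjJacobi n a b) (x : Fin n → ℝ)
    (p : MvPolynomial (Fin n) ℝ) :
    sphereMean n (multiplier x * projZonal a x 0 * p) =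
      a 0 * sphereMean n (projZonal a x 1 * p) +
      b 0 * (∑ i, x i ^ 2) * sphereMean n (projZonal a x 0 * p) := by
  rw [multiplier_mul_projZonal_zero h, ← sphereMean_normSqPoly_mul hn (projZonal a x 0 * p),
    ← sphereMean_C_mul, ← sphereMean_C_mul, ← map_add, C_mul]
  congr 1; ring

lemma sphereMean_multiplier_succ (hn : 3 ≤ n) (h : IsProjJacobi n a b) (x : Fin n → ℝ) (l : ℕ)
    (p : MvPolynomial (Fin n) ℝ) :
    sphereMean n (multiplier x * projZonal a x (l + 1) * p) =
      a (l + 1) * sphereMean n (projZonal a x (l + 2) * p) +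
      b (l + 1) * (∑ i, x i ^ 2) * sphereMean n (projZonal a x (l + 1) * p) +
      a l * (∑ i, x i ^ 2) ^ 2 * sphereMean n (projZonal a x l * p) := by
  rw [multiplier_mul_projZonal_succ h, ← sphereMean_normSqPoly_mul hn (projZonal a x (l + 1) * p),
    ← sphereMean_normSqPoly_pow_mul hn 2 (projZonal a x l * p),
    ← sphereMean_C_mul, ← sphereMean_C_mul, ← sphereMean_C_mul, ← map_add, ← map_add, C_mul, C_mul,
    C_pow]
  congr 1; ring

lemma sphereMean_projZonal_mul (hn : 3 ≤ n) (h : IsProjJacobi n a b) (x : Fin n → ℝ) (i j : ℕ) :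
    sphereMean n (projZonal a x i * projZonal a x j) =
      if i = j then (∑ i, x i ^ 2) ^ (2 * i) else 0 := by
  set r := ∑ i, x i ^ 2
  have hz : projZonal a x 0 = 1 := by simp [projZonal, normFactor, zonal]
  induction i using Nat.twoStepInduction generalizing j with
  | zero =>
    rw [hz, one_mul]
    cases j with
    | zero => simp [hz, sphereMean_one]
    | succ j => simp [sphereMean_projZonal hn x (Nat.succ_pos j)]
  | one =>
    cases j with
    | zero => rw [hz, mul_one, sphereMean_projZonal hn x one_pos]; simp
    | succ j =>
      have e1 := sphereMean_multiplier_zero hn h x (projZonal a x (j + 1))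
      have e2 := sphereMean_multiplier_succ hn h x j (projZonal a x 0)
      rw [mul_right_comm, e2] at e1
      rw [hz, mul_one, mul_one, mul_one, one_mul, sphereMean_projZonal hn x (Nat.succ_pos j),
        sphereMean_projZonal hn x (Nat.succ_pos (j + 1))] at e1
      refine mul_left_cancel₀ (h.pos 0).ne' ?_
      cases j with
      | zero =>
        rw [hz, sphereMean_one] at e1
        simp only [zero_add, if_true] at e1 ⊢
        linear_combination -e1
      | succ j =>
        rw [sphereMean_projZonal hn x (Nat.succ_pos j)] at e1
        rw [if_neg (by omega)]
        linear_combination -e1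
  | more i h0 h1 =>
    cases j with
    | zero => rw [hz, mul_one, sphereMean_projZonal hn x (Nat.succ_pos _)]; simp
    | succ j =>
      have e1 := sphereMean_multiplier_succ hn h x i (projZonal a x (j + 1))
      have e2 := sphereMean_multiplier_succ hn h x j (projZonal a x (i + 1))
      rw [mul_right_comm, e1, mul_comm (projZonal a x (j + 2)), mul_comm (projZonal a x j), h0,
        mul_comm (projZonal a x (j + 1)), h1 (j + 2), h1 (j + 1), h1 j] at e2
      refine mul_left_cancel₀ (h.pos (i + 1)).ne' ?_
      rcases eq_or_ne j (i + 1) with rfl | hj1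
      · split_ifs at e2 ⊢ <;> first | omega | linear_combination e2
      rcases eq_or_ne j i with rfl | hj2
      · split_ifs at e2 ⊢ <;> first | omega | linear_combination e2
      rcases eq_or_ne i (j + 1) with rfl | hj3
      · split_ifs at e2 ⊢ <;> first | omega | linear_combination e2
      split_ifs at e2 ⊢ <;> first | omega | linear_combination e2

lemma sum_mul_projZonal_nonneg (hn : 3 ≤ n) (h : IsProjJacobi n a b) {ι : Type*} (S : Finset ι)
    (v : ι → Fin n → ℝ) (k l : ℕ) :
    0 ≤ ∑ i ∈ S, ∑ j ∈ S,
      eval (v j) (projZonal a (v i) k) * eval (v j) (projZonal a (v i) l) := by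
  obtain ⟨s, φ, hφ⟩ := exists_features_zonal hn (2 * k)
  obtain ⟨t, ψ, hψ⟩ := exists_features_zonal hn (2 * l)
  have hk := normFactor_pos hn h k
  have hl := normFactor_pos hn h l
  have : ∑ i ∈ S, ∑ j ∈ S,
      eval (v j) (projZonal a (v i) k) * eval (v j) (projZonal a (v i) l) =
      normFactor n a k * normFactor n a l *
        ∑ d ∈ s, ∑ e ∈ t, (∑ i ∈ S, eval (v i) (φ d) * eval (v i) (ψ e)) ^ 2 := by
    simp only [projZonal, map_mul, eval_C, hφ, hψ, sq, Finset.sum_mul_sum]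
    have e : ∀ i j, normFactor n a k * (∑ d ∈ s, eval (v i) (φ d) * eval (v j) (φ d)) *
        (normFactor n a l * ∑ e ∈ t, eval (v i) (ψ e) * eval (v j) (ψ e)) =
        normFactor n a k * normFactor n a l * ∑ d ∈ s, ∑ e ∈ t,
          (eval (v i) (φ d) * eval (v i) (ψ e)) * (eval (v j) (φ d) * eval (v j) (ψ e)) := by
      intro i j
      rw [mul_mul_mul_comm, Finset.sum_mul_sum]
      congr 1
      exact Finset.sum_congr rfl fun d _ => Finset.sum_congr rfl fun e _ => by ring
    simp only [e, ← Finset.mul_sum]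
    congr 1
    rw [Finset.sum_congr rfl fun i _ => Finset.sum_comm, Finset.sum_comm]
    refine Finset.sum_congr rfl fun d _ => ?_
    rw [Finset.sum_congr rfl fun i _ => Finset.sum_comm, Finset.sum_comm]
    simp only [Finset.mul_sum]
  rw [this]
  positivity

lemma card_sq_le_sum_projZonal_sq (hn : 3 ≤ n) (h : IsProjJacobi n a b) {ι : Type*}
    (S : Finset ι) (v : ι → Fin n → ℝ) (hv : ∀ i ∈ S, ∑ j, v i j ^ 2 = 1) (k : ℕ) :
    (S.card : ℝ) ^ 2 ≤ ∑ i ∈ S, ∑ j ∈ S, eval (v j) (projZonal a (v i) k) ^ 2 := by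
  obtain ⟨s, φ, hφ⟩ := exists_features_zonal hn (2 * k)
  have := card_sq_le_sum_kernel (sphereMean n) (s ×ˢ s)
    (fun p => C (normFactor n a k) * φ p.1 * φ p.2) (fun x => projZonal a x k * projZonal a x k)
    (normSqPoly n ^ (2 * k)) ?_ ?_ ?_ S v ?_
  · simpa only [map_mul, sq] using this
  · intro x y
    simp only [projZonal, map_mul, eval_C, hφ]
    rw [mul_mul_mul_comm, Finset.sum_mul_sum, Finset.sum_product, Finset.mul_sum]
    refine Finset.sum_congr rfl fun d _ => ?_
    rw [Finset.mul_sum]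
    exact Finset.sum_congr rfl fun e _ => by ring
  · intro x
    rw [sphereMean_projZonal_mul hn h, if_pos rfl, map_pow, eval_normSqPoly]
  · rw [← mul_one (normSqPoly n ^ (2 * k)), sphereMean_normSqPoly_pow_mul hn, sphereMean_one]
  · intro i hi
    rw [map_pow, eval_normSqPoly, hv i hi, one_pow]

end Orthonormal

section LargestEigenvalue
open Matrix

variable {m : ℕ} {M : Matrix (Fin (m + 1)) (Fin (m + 1)) ℝ}

lemma dotProduct_self_pos {w : Fin (m + 1) → ℝ} (hw : w ≠ 0) : 0 < w ⬝ᵥ w :=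
  lt_of_le_of_ne (Finset.sum_nonneg fun i _ => mul_self_nonneg (w i))
    fun h => hw (dotProduct_self_eq_zero.1 h.symm)

lemma hasEigenvalue_maxEig (hM : M.IsHermitian) :
    Module.End.HasEigenvalue (Matrix.toLin' M) (maxEig M) := by
  refine Set.Nonempty.csSup_mem (s := {μ | Module.End.HasEigenvalue (Matrix.toLin' M) μ}) ?_
    (Module.End.finite_hasEigenvalue _)
  refine ⟨hM.eigenvalues 0, Module.End.hasEigenvalue_of_hasEigenvector
    (x := (hM.eigenvectorBasis 0).ofLp) ⟨?_, ?_⟩⟩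
  · rw [Module.End.mem_eigenspace_iff, toLin'_apply, hM.mulVec_eigenvectorBasis]
  · intro h
    exact hM.eigenvectorBasis.toBasis.ne_zero 0 (by ext i; simpa using congrFun h i)

lemma exists_eigenvector_maxEig (hM : M.IsHermitian) :
    ∃ w : Fin (m + 1) → ℝ, w ≠ 0 ∧ M *ᵥ w = maxEig M • w := by
  obtain ⟨w, hw⟩ := (hasEigenvalue_maxEig hM).exists_hasEigenvector
  exact ⟨w, hw.2, by simpa [toLin'_apply] using hw.apply_eq_smul⟩

lemma posSemidef_maxEig_sub (hM : M.IsHermitian) : (maxEig M • 1 - M).PosSemidef := by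
  have hA : (maxEig M • 1 - M).IsHermitian :=
    (isHermitian_one.smul (IsSelfAdjoint.all _)).sub hM
  rw [hA.posSemidef_iff_eigenvalues_nonneg]
  intro i
  have h := hA.mulVec_eigenvectorBasis i
  have hne : (hA.eigenvectorBasis i).ofLp ≠ 0 := fun h =>
    hA.eigenvectorBasis.toBasis.ne_zero i (by ext j; simpa using congrFun h j)
  have hle : maxEig M - hA.eigenvalues i ≤ maxEig M := by
    refine le_csSup (Module.End.finite_hasEigenvalue _).bddAbove
      (Module.End.hasEigenvalue_of_hasEigenvector (x := (hA.eigenvectorBasis i).ofLp) ⟨?_, hne⟩)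
    rw [Module.End.mem_eigenspace_iff, toLin'_apply, sub_smul, ← h, sub_mulVec, smul_mulVec,
      one_mulVec, sub_sub_cancel]
  simpa using hle

lemma dotProduct_mulVec_le_maxEig (hM : M.IsHermitian) (w : Fin (m + 1) → ℝ) :
    w ⬝ᵥ M *ᵥ w ≤ maxEig M * (w ⬝ᵥ w) := by
  have := (posSemidef_maxEig_sub hM).dotProduct_mulVec_nonneg w
  rw [star_trivial, sub_mulVec, smul_mulVec, one_mulVec, dotProduct_sub, dotProduct_smul,
    smul_eq_mul] at this
  linarith

lemma mulVec_eq_of_maxEig_le (hM : M.IsHermitian) {w : Fin (m + 1) → ℝ}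
    (h : maxEig M * (w ⬝ᵥ w) ≤ w ⬝ᵥ M *ᵥ w) : M *ᵥ w = maxEig M • w := by
  have h0 : star w ⬝ᵥ (maxEig M • 1 - M) *ᵥ w = 0 := by
    rw [star_trivial, sub_mulVec, smul_mulVec, one_mulVec, dotProduct_sub, dotProduct_smul,
      smul_eq_mul]
    linarith [dotProduct_mulVec_le_maxEig hM w]
  rw [(posSemidef_maxEig_sub hM).dotProduct_mulVec_zero_iff, sub_mulVec, smul_mulVec,
    one_mulVec, sub_eq_zero] at h0
  exact h0.symm

/-- A symmetric matrix with nonnegative off-diagonal entries has a nonnegative eigenvector for its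
largest eigenvalue. -/
lemma exists_nonneg_eigenvector_maxEig (hM : M.IsHermitian) (hoff : ∀ i j, i ≠ j → 0 ≤ M i j) :
    ∃ w : Fin (m + 1) → ℝ, w ≠ 0 ∧ 0 ≤ w ∧ M *ᵥ w = maxEig M • w := by
  obtain ⟨w, hw0, hw⟩ := exists_eigenvector_maxEig hM
  refine ⟨|w|, by simpa using hw0, abs_nonneg w, mulVec_eq_of_maxEig_le hM ?_⟩
  have h1 : |w| ⬝ᵥ |w| = w ⬝ᵥ w := by simp [dotProduct]
  have h2 : maxEig M * (w ⬝ᵥ w) = w ⬝ᵥ M *ᵥ w := by rw [hw, dotProduct_smul, smul_eq_mul]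
  rw [h1, h2]
  simp only [dotProduct, mulVec, Finset.mul_sum, Pi.abs_apply]
  refine Finset.sum_le_sum fun i _ => Finset.sum_le_sum fun j _ => ?_
  rcases eq_or_ne i j with rfl | hij
  · refine le_of_eq ?_
    linear_combination (-M i i) * abs_mul_abs_self (w i)
  · calc w i * (M i j * w j) ≤ |w i * (M i j * w j)| := le_abs_self _
      _ = |w i| * (M i j * |w j|) := by rw [abs_mul, abs_mul, abs_of_nonneg (hoff i j hij)]

end LargestEigenvalue

section Tridiagonal
open Matrix
variable {k : ℕ} {d o : ℕ → ℝ}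

lemma isHermitian_tridiag (k : ℕ) (d o : ℕ → ℝ) : (Tridiag k d o).IsHermitian := by
  ext i j
  simp only [conjTranspose_apply, Tridiag, of_apply, star_trivial]
  split_ifs <;> first | omega | simp_all

lemma tridiag_mulVec_apply (k : ℕ) (d o q : ℕ → ℝ) (i : Fin (k + 1)) :
    (Tridiag k d o *ᵥ fun j => q j) i =
      d i * q i + (if (i : ℕ) = k then 0 else o i * q (i + 1)) +
        (if (i : ℕ) = 0 then 0 else o (i - 1) * q (i - 1)) := by
  obtain ⟨i, hi⟩ := i
  simp only [mulVec, dotProduct, Tridiag, of_apply]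
  rw [Fin.sum_univ_eq_sum_range (fun j => (if i = j then d i else if i + 1 = j then o i else
    if j + 1 = i then o j else 0) * q j) (k + 1)]
  have e : ∀ j, (if i = j then d i else if i + 1 = j then o i else
      if j + 1 = i then o j else 0) * q j = (if i = j then d i * q j else 0) +
      (if i + 1 = j then o i * q j else 0) +
      (if i - 1 = j then if i = 0 then 0 else o j * q j else 0) := by
    intro j
    split_ifs <;> first | omega | simp
  simp only [e, Finset.sum_add_distrib, Finset.sum_ite_eq, Finset.mem_range]
  split_ifs <;> first | omega | simp

/-- A Jacobi matrix has a nonnegative top eigenvector with a positive last entry. -/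
lemma exists_perron_tridiag (ho : ∀ l, 0 < o l) :
    ∃ w : Fin (k + 1) → ℝ, 0 ≤ w ∧ 0 < w (Fin.last k) ∧
      Tridiag k d o *ᵥ w = maxEig (Tridiag k d o) • w := by
  have hoff : ∀ i j, i ≠ j → 0 ≤ Tridiag k d o i j := by
    intro i j hij
    have : (i : ℕ) ≠ j := fun h => hij (Fin.ext h)
    simp only [Tridiag, of_apply, if_neg this]
    have h1 := (ho i).le
    have h2 := (ho j).le
    split_ifs <;> first | assumption | exact le_rfl
  obtain ⟨w, hw0, hw, he⟩ := exists_nonneg_eigenvector_maxEig (isHermitian_tridiag k d o) hoff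
  refine ⟨w, hw, lt_of_le_of_ne (hw _) fun hlast => hw0 ?_, he⟩
  have key : ∀ r, ∀ i : Fin (k + 1), (i : ℕ) + r = k → w i = 0 := by
    intro r
    induction r with
    | zero =>
      intro i hi
      rw [hlast]
      congr 1
      exact Fin.ext hi
    | succ r ih =>
      intro i hi
      set i' : Fin (k + 1) := ⟨i + 1, by omega⟩
      have h0 : w i' = 0 := ih i' (by simp only [i']; omega)
      have hrow := congrFun he i'
      rw [Pi.smul_apply, h0, smul_zero, mulVec, dotProduct,
        Finset.sum_eq_zero_iff_of_nonneg] at hrow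
      · have := hrow i (Finset.mem_univ _)
        have hT : Tridiag k d o i' i = o i := by
          simp only [Tridiag, of_apply, i']
          split_ifs <;> first | omega | rfl
        rw [hT] at this
        exact (mul_eq_zero.1 this).resolve_left (ho i).ne'
      · intro j _
        rcases eq_or_ne i' j with rfl | hj
        · rw [h0, mul_zero]
        · exact mul_nonneg (hoff _ _ hj) (hw j)
  funext i
  exact key (k - i) i (by omega)

lemma maxEig_tridiag_le_succ {d' : ℕ → ℝ} (hd : ∀ i ≤ k, d' i = d i) :
    maxEig (Tridiag k d o) ≤ maxEig (Tridiag (k + 1) d' o) := by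
  obtain ⟨w, hw0, hw⟩ := exists_eigenvector_maxEig (isHermitian_tridiag k d o)
  have h := dotProduct_mulVec_le_maxEig (isHermitian_tridiag (k + 1) d' o)
    (Fin.snoc (α := fun _ => ℝ) w 0)
  have hT : ∀ i j : Fin (k + 1),
      Tridiag (k + 1) d' o i.castSucc j.castSucc = Tridiag k d o i j := by
    intro i j
    simp [Tridiag, hd i (by omega)]
  have h1 : (Fin.snoc (α := fun _ => ℝ) w 0) ⬝ᵥ (Fin.snoc (α := fun _ => ℝ) w 0) = w ⬝ᵥ w := by
    simp [dotProduct, Fin.sum_univ_castSucc]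
  have h2 : (Fin.snoc (α := fun _ => ℝ) w 0) ⬝ᵥ Tridiag (k + 1) d' o *ᵥ
      (Fin.snoc (α := fun _ => ℝ) w 0) = w ⬝ᵥ Tridiag k d o *ᵥ w := by
    simp [dotProduct, mulVec, Fin.sum_univ_castSucc (n := k + 1), hT]
  rw [h1, h2, hw, dotProduct_smul, smul_eq_mul] at h
  exact le_of_mul_le_mul_right h
    (dotProduct_self_pos hw0)

lemma tridiag_mono_maxEig {d' : ℕ → ℝ} (hd : ∀ i ≤ k, d' i ≤ d i) :
    maxEig (Tridiag k d' o) ≤ maxEig (Tridiag k d o) := by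
  obtain ⟨w, hw0, hw⟩ := exists_eigenvector_maxEig (isHermitian_tridiag k d' o)
  have h := dotProduct_mulVec_le_maxEig (isHermitian_tridiag k d o) w
  have hT : w ⬝ᵥ Tridiag k d' o *ᵥ w ≤ w ⬝ᵥ Tridiag k d o *ᵥ w := by
    simp only [dotProduct, mulVec, Finset.mul_sum]
    refine Finset.sum_le_sum fun i _ => Finset.sum_le_sum fun j _ => ?_
    simp only [Tridiag, of_apply]
    split_ifs with hij
    · obtain rfl := Fin.ext hij
      have := mul_le_mul_of_nonneg_right (hd i (by omega)) (mul_self_nonneg (w i))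
      linarith
    all_goals exact le_rfl
  rw [hw, dotProduct_smul, smul_eq_mul] at hT
  exact le_of_mul_le_mul_right (hT.trans h)
    (dotProduct_self_pos hw0)

end Tridiagonal

section GeneralizedBinomial

lemma genBinom_add_one_left {x y : ℝ} (h1 : x + 1 ≠ 0) (h2 : x - y + 1 ≠ 0) :
    genBinom (x + 1) y = genBinom x y * ((x + 1) / (x - y + 1)) := by
  rw [genBinom, genBinom, Real.Gamma_add_one h1, show x + 1 - y + 1 = x - y + 1 + 1 by ring,
    Real.Gamma_add_one h2, div_mul_div_comm]
  congr 1 <;> ring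

lemma genBinom_add_one_add_one {x y : ℝ} (h1 : x + 1 ≠ 0) (h2 : y + 1 ≠ 0) :
    genBinom (x + 1) (y + 1) = genBinom x y * ((x + 1) / (y + 1)) := by
  rw [genBinom, genBinom, Real.Gamma_add_one h1, add_sub_add_right_eq_sub,
    Real.Gamma_add_one h2, div_mul_div_comm]
  congr 1 <;> ring

lemma genBinom_self {x : ℝ} (h : 0 < x + 1) : genBinom x x = 1 := by
  rw [genBinom, sub_self, zero_add, Real.Gamma_one, mul_one, div_self (Real.Gamma_pos_of_pos h).ne']

lemma genBinom_zero_right {x : ℝ} (h : 0 < x + 1) : genBinom x 0 = 1 := by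
  rw [genBinom, sub_zero, zero_add, Real.Gamma_one, one_mul, div_self (Real.Gamma_pos_of_pos h).ne']

end GeneralizedBinomial

section JacobiCoefficients
variable {n : ℕ}

lemma isProjJacobi_of_eq (hn : 3 ≤ n) {α β : ℝ} (hα : α = ((n : ℝ) - 3) / 2)
    (hβ : β = -(1 / 2)) {a b : ℕ → ℝ}
    (ha : a = fun l : ℕ => ((α + β + 2) / (2 * l + α + β + 2))
      * Real.sqrt (((l : ℝ) + α + 1) * ((l : ℝ) + β + 1) * ((l : ℝ) + 1) * ((l : ℝ) + α + β + 1)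
        / ((2 * l + α + β + 3) * (2 * l + α + β + 1))))
    (hb : b = fun l : ℕ => 2 * (α - β) * (l : ℝ) * ((l : ℝ) + α + β + 1)
      / ((2 * (l : ℝ) + α + β) * (2 * (l : ℝ) + α + β + 2))) :
    IsProjJacobi n a b := by
  have hn' : (3 : ℝ) ≤ n := by exact_mod_cast hn
  have hpos : ∀ l : ℕ, 0 < ((l : ℝ) + α + 1) * ((l : ℝ) + β + 1) * ((l : ℝ) + 1) *
      ((l : ℝ) + α + β + 1) / ((2 * l + α + β + 3) * (2 * l + α + β + 1)) := by
    intro l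
    have hl : (0 : ℝ) ≤ l := l.cast_nonneg
    have h1 : 0 < (l : ℝ) + α + 1 := by linarith
    have h2 : 0 < (l : ℝ) + β + 1 := by linarith
    have h3 : 0 < (l : ℝ) + α + β + 1 := by linarith
    have h4 : 0 < 2 * (l : ℝ) + α + β + 3 := by linarith
    have h5 : 0 < 2 * (l : ℝ) + α + β + 1 := by linarith
    positivity
  refine ⟨fun l => ?_, fun l => ?_, ?_, fun l => ?_⟩
  · have hl : (0 : ℝ) ≤ l := l.cast_nonneg
    have h1 : 0 < α + β + 2 := by linarith
    have h2 : 0 < 2 * (l : ℝ) + α + β + 2 := by linarith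
    rw [ha]
    exact mul_pos (div_pos h1 h2) (Real.sqrt_pos.2 (hpos l))
  · have hl : (0 : ℝ) ≤ l := l.cast_nonneg
    have h1 : 2 * (2 * (l : ℝ)) + n - 2 ≠ 0 := by linarith
    have h2 : 2 * (2 * (l : ℝ)) + n ≠ 0 := by linarith
    have h3 : 2 * (2 * (l : ℝ) + 1) + n ≠ 0 := by linarith
    have h4 : 2 * (2 * (l : ℝ) + 1) + n - 2 ≠ 0 := by linarith
    simp only [ha]
    rw [mul_pow, Real.sq_sqrt (hpos l).le]
    simp only [gegenbauerCoeff, hα, hβ]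
    push_cast
    rw [show 2 * (l : ℝ) + (n - 3) / 2 + -(1 / 2) + 3 = (2 * (2 * (l : ℝ) + 1) + n) / 2 by ring,
      show 2 * (l : ℝ) + (n - 3) / 2 + -(1 / 2) + 1 = (2 * (2 * (l : ℝ)) + n - 2) / 2 by ring,
      show 2 * (l : ℝ) + (n - 3) / 2 + -(1 / 2) + 2 = (2 * (2 * (l : ℝ)) + n) / 2 by ring,
      show 2 * (2 * (l : ℝ) + 1) + n - 2 = 2 * (2 * (l : ℝ)) + n by ring]
    field_simp
    ring
  · have h1 : (n : ℝ) ≠ 0 := by linarith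
    have h2 : (n : ℝ) - 2 ≠ 0 := by linarith
    rw [hb]
    simp only [gegenbauerCoeff, CharP.cast_eq_zero, mul_zero, zero_add, zero_mul, zero_div]
    field_simp
    ring
  · have hl : (0 : ℝ) ≤ l := l.cast_nonneg
    have h1 : 4 * (l : ℝ) + n ≠ 0 := by linarith
    have h2 : 4 * (l : ℝ) + n + 2 ≠ 0 := by linarith
    have h3 : 4 * (l : ℝ) + n + 4 ≠ 0 := by linarith
    rw [hb]
    simp only [gegenbauerCoeff, hα, hβ]
    push_cast
    rw [show 2 * ((l : ℝ) + 1) + (n - 3) / 2 + -(1 / 2) = (4 * (l : ℝ) + n) / 2 by ring,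
      show 2 * (2 * (l : ℝ) + 1) + n = 4 * l + n + 2 by ring,
      show 4 * (l : ℝ) + n + 2 - 2 = 4 * l + n by ring,
      show 2 * (2 * (l : ℝ) + 2) + n = 4 * l + n + 4 by ring,
      show 4 * (l : ℝ) + n + 4 - 2 = 4 * l + n + 2 by ring,
      show (4 * (l : ℝ) + n) / 2 + 2 = (4 * l + n + 4) / 2 by ring]
    field_simp
    ring

end JacobiCoefficients

section DiagonalValues
variable {n : ℕ} {a b : ℕ → ℝ} {x : Fin n → ℝ}

lemma eval_zonal_succ_self (hn : 3 ≤ n) (hx : ∑ i, x i ^ 2 = 1) (m : ℕ) :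
    eval x (zonal x (m + 1)) = (m + n - 2) / (2 * m + n - 2) * eval x (zonal x m) := by
  have hn' : (3 : ℝ) ≤ n := by exact_mod_cast hn
  induction m with
  | zero =>
    have : (n : ℝ) - 2 ≠ 0 := by linarith
    have e : eval x (lin x) = 1 := by
      rw [eval_lin, ← hx]
      exact Finset.sum_congr rfl fun i _ => (sq _).symm
    simp [zonal, e, this]
  | succ m ih =>
    have hm : (0 : ℝ) ≤ m := m.cast_nonneg
    have h1 : (m : ℝ) + n - 2 ≠ 0 := by linarith
    have h2 : 2 * (m : ℝ) + n - 2 ≠ 0 := by linarith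
    have h3 : 2 * (m : ℝ) + n ≠ 0 := by linarith
    have e : eval x (lin x) = 1 := by
      rw [eval_lin, ← hx]
      exact Finset.sum_congr rfl fun i _ => (sq _).symm
    rw [zonal_add_two]
    simp only [map_sub, map_mul, eval_C, eval_normSqPoly, e, hx, ih, gegenbauerCoeff]
    push_cast
    rw [show 2 * ((m : ℝ) + 1) + n - 2 = 2 * m + n by ring]
    field_simp
    ring

lemma eval_zonal_self_pos (hn : 3 ≤ n) (hx : ∑ i, x i ^ 2 = 1) (m : ℕ) :
    0 < eval x (zonal x m) := by
  have hn' : (3 : ℝ) ≤ n := by exact_mod_cast hn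
  induction m with
  | zero => simp [zonal]
  | succ m ih =>
    have hm : (0 : ℝ) ≤ m := m.cast_nonneg
    rw [eval_zonal_succ_self hn hx]
    exact mul_pos (div_pos (by linarith) (by linarith)) ih

lemma eval_projZonal_self_pos (hn : 3 ≤ n) (h : IsProjJacobi n a b) (hx : ∑ i, x i ^ 2 = 1)
    (l : ℕ) : 0 < eval x (projZonal a x l) := by
  rw [projZonal, map_mul, eval_C]
  exact mul_pos (normFactor_pos hn h l) (eval_zonal_self_pos hn hx _)

lemma mul_eval_projZonal_self (h : IsProjJacobi n a b) (l : ℕ) :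
    a l * eval x (projZonal a x l) * eval x (projZonal a x (l + 1)) =
      n / 2 * normFactor n a l ^ 2 * eval x (zonal x (2 * l)) * eval x (zonal x (2 * l + 2)) := by
  simp only [projZonal, map_mul, eval_C, show 2 * (l + 1) = 2 * l + 2 by ring]
  linear_combination normFactor n a l * eval x (zonal x (2 * l)) * eval x (zonal x (2 * l + 2)) *
    mul_normFactor_succ h l

lemma mul_eval_projZonal_self_eq_genBinom (hn : 3 ≤ n) {α β : ℝ} (hα : α = ((n : ℝ) - 3) / 2)
    (hβ : β = -(1 / 2)) (h : IsProjJacobi n a b) (hx : ∑ i, x i ^ 2 = 1) (k : ℕ) :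
    a k * eval x (projZonal a x k) * eval x (projZonal a x (k + 1)) =
      (α + β + 2) * ((k : ℝ) + α + 1) / (2 * (k : ℝ) + α + β + 2) * genBinom ((k : ℝ) + α) α *
        genBinom ((k : ℝ) + α + β + 1) (k : ℝ) / genBinom ((k : ℝ) + β) β := by
  have hn' : (3 : ℝ) ≤ n := by exact_mod_cast hn
  rw [mul_eval_projZonal_self h]
  induction k with
  | zero =>
    have e1 := eval_zonal_succ_self hn hx 0
    have e2 := eval_zonal_succ_self hn hx 1
    have h1 : (n : ℝ) - 2 ≠ 0 := by linarith
    have h2 : (n : ℝ) ≠ 0 := by linarith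
    simp only [CharP.cast_eq_zero, zero_add]
    rw [genBinom_self (by linarith), genBinom_self (by linarith), genBinom_zero_right (by linarith)]
    rw [zero_add] at e1
    simp only [normFactor, mul_zero, zero_add, hα, hβ, e1, e2]
    simp only [zonal, map_one]
    rw [show ((n : ℝ) - 3) / 2 + -(1 / 2) + 2 = n / 2 by ring]
    push_cast
    rw [show (2 : ℝ) * 1 + n - 2 = n by ring, show (2 : ℝ) * 0 + n - 2 = n - 2 by ring,
      show (0 : ℝ) + n - 2 = n - 2 by ring]
    field_simp
    ring
  | succ k ih =>
    have hk : (0 : ℝ) ≤ k := k.cast_nonneg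
    have e1 := eval_zonal_succ_self hn hx (2 * k)
    have e2 := eval_zonal_succ_self hn hx (2 * k + 1)
    have e3 := eval_zonal_succ_self hn hx (2 * k + 2)
    have e4 := eval_zonal_succ_self hn hx (2 * k + 3)
    have hκ : gegenbauerCoeff n (2 * k) * gegenbauerCoeff n (2 * k + 1) *
        normFactor n a (k + 1) ^ 2 = normFactor n a k ^ 2 := by
      have h0 : ((n : ℝ) / 2) ^ 2 ≠ 0 := by positivity
      refine mul_left_cancel₀ h0 ?_
      linear_combination (-normFactor n a (k + 1) ^ 2) * h.sq_eq k +
        (a k * normFactor n a (k + 1) + n / 2 * normFactor n a k) * mul_normFactor_succ h k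
    have g1 : genBinom ((k : ℝ) + 1 + α) α = genBinom (k + α) α * ((k + α + 1) / (k + 1)) := by
      rw [show (k : ℝ) + 1 + α = k + α + 1 by ring, genBinom_add_one_left (by linarith)
        (by linarith), add_sub_cancel_right]
    have g2 : genBinom ((k : ℝ) + 1 + α + β + 1) (k + 1) =
        genBinom (k + α + β + 1) k * ((k + α + β + 2) / (k + 1)) := by
      rw [show (k : ℝ) + 1 + α + β + 1 = k + α + β + 1 + 1 by ring, genBinom_add_one_add_one
        (by linarith) (by linarith), show (k : ℝ) + α + β + 1 + 1 = k + α + β + 2 by ring]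
    have g3 : genBinom ((k : ℝ) + 1 + β) β = genBinom (k + β) β * ((k + β + 1) / (k + 1)) := by
      rw [show (k : ℝ) + 1 + β = k + β + 1 by ring, genBinom_add_one_left (by linarith)
        (by linarith), add_sub_cancel_right]
    have p1 : 4 * (k : ℝ) + n - 2 ≠ 0 := by linarith
    have p2 : 4 * (k : ℝ) + n ≠ 0 := by linarith
    have p3 : 4 * (k : ℝ) + n + 2 ≠ 0 := by linarith
    have p4 : 4 * (k : ℝ) + n + 4 ≠ 0 := by linarith
    have p5 : 2 * (k : ℝ) + n - 2 ≠ 0 := by linarith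
    have p6 : 2 * (k : ℝ) + n - 1 ≠ 0 := by linarith
    have p7 : (k : ℝ) + 1 ≠ 0 := by linarith
    have p8 : 2 * (k : ℝ) + 1 ≠ 0 := by linarith
    have hc : gegenbauerCoeff n (2 * k) * gegenbauerCoeff n (2 * k + 1) =
        (2 * k + 1) * (2 * k + n - 2) * (2 * (k + 1)) * (2 * k + n - 1) /
          ((4 * k + n - 2) * (4 * k + n) ^ 2 * (4 * k + n + 2)) := by
      simp only [gegenbauerCoeff]
      push_cast
      rw [show 2 * (2 * (k : ℝ)) + n = 4 * k + n by ring,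
        show 2 * (2 * (k : ℝ) + 1) + n = 4 * k + n + 2 by ring, add_sub_cancel_right]
      field_simp
      ring
    have hρ : eval x (zonal x (2 * k + 4)) = (2 * k + n - 2) * (2 * k + n - 1) * (2 * k + n) *
        (2 * k + n + 1) / ((4 * k + n - 2) * (4 * k + n) * (4 * k + n + 2) * (4 * k + n + 4)) *
          eval x (zonal x (2 * k)) := by
      rw [e4, e3, e2, e1]
      push_cast
      rw [show 2 * (2 * (k : ℝ)) + n - 2 = 4 * k + n - 2 by ring,
        show 2 * (2 * (k : ℝ) + 1) + n - 2 = 4 * k + n by ring,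
        show 2 * (2 * (k : ℝ) + 2) + n - 2 = 4 * k + n + 2 by ring,
        show 2 * (2 * (k : ℝ) + 3) + n - 2 = 4 * k + n + 4 by ring]
      field_simp
      ring
    rw [show 2 * (k + 1) + 2 = 2 * k + 4 by ring, show 2 * (k + 1) = 2 * k + 2 by ring, hρ]
    push_cast
    rw [g1, g2, g3]
    have hκ' : normFactor n a (k + 1) ^ 2 = normFactor n a k ^ 2 *
        (((4 * k + n - 2) * (4 * k + n) ^ 2 * (4 * k + n + 2)) /
          ((2 * k + 1) * (2 * k + n - 2) * (2 * (k + 1)) * (2 * k + n - 1))) := by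
      rw [← hκ, hc, mul_right_comm, ← inv_div ((2 * (k : ℝ) + 1) * _ * _ * _),
        mul_inv_cancel₀ (by simp [*]), one_mul]
    rw [hκ']
    trans (n / 2 * normFactor n a k ^ 2 * eval x (zonal x (2 * k)) *
      eval x (zonal x (2 * k + 2))) * (((2 * k + n) * (2 * k + n + 1) * (4 * k + n)) /
        (2 * (2 * k + 1) * (k + 1) * (4 * k + n + 4)))
    · field_simp
    rw [ih, show (k : ℝ) + β + 1 = (2 * k + 1) / 2 by rw [hβ]; ring,
      show 2 * ((k : ℝ) + 1) + α + β + 2 = (4 * k + n + 4) / 2 by rw [hα, hβ]; ring,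
      show 2 * (k : ℝ) + α + β + 2 = (4 * k + n) / 2 by rw [hα, hβ]; ring,
      show (k : ℝ) + α + β + 2 = (2 * k + n) / 2 by rw [hα, hβ]; ring,
      show (k : ℝ) + 1 + α + 1 = (2 * k + n + 1) / 2 by rw [hα]; ring]
    generalize genBinom ((k : ℝ) + α) α = A
    generalize genBinom ((k : ℝ) + α + β + 1) k = B
    generalize genBinom ((k : ℝ) + β) β = D
    rw [mul_comm D, div_mul_eq_div_div]
    field_simp

end DiagonalValues

section SpectralBound
open Matrix
variable {n : ℕ} {a b : ℕ → ℝ}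

/-- A Christoffel–Darboux type identity for an eigenvector of a corner-perturbed Jacobi matrix. -/
lemma sub_mul_sum_eigenvector {q : ℕ → ℝ} {u : ℝ} (h0 : u * q 0 = a 0 * q 1 + b 0 * q 0)
    (hs : ∀ l, u * q (l + 1) = a (l + 1) * q (l + 2) + b (l + 1) * q (l + 1) + a l * q l)
    {k : ℕ} {θ μ : ℝ} {w : Fin (k + 1) → ℝ}
    (hw : Tridiag k (fun i => b i - if i = k then θ else 0) a *ᵥ w = μ • w) :
    (u - μ) * ∑ i, w i * q i = w (Fin.last k) * (a k * q (k + 1) + θ * q k) := by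
  set T := Tridiag k (fun i => b i - if i = k then θ else 0) a
  have hrow : ∀ i : Fin (k + 1), u * q i = (T *ᵥ fun j : Fin (k + 1) => q j) i +
      if i = Fin.last k then a k * q (k + 1) + θ * q k else 0 := by
    intro i
    have hi : (i = Fin.last k) ↔ (i : ℕ) = k := by rw [Fin.ext_iff, Fin.val_last]
    rw [tridiag_mulVec_apply]
    simp only [hi]
    obtain ⟨i, hik⟩ := i
    simp only
    cases i with
    | zero =>
      rw [h0, if_pos rfl, zero_add]
      split_ifs with h
      · subst h; ring
      · ring
    | succ i =>
      rw [hs, if_neg (Nat.succ_ne_zero i), Nat.add_sub_cancel]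
      split_ifs with h
      · subst h; ring
      · ring
  have hsymm : w ⬝ᵥ (T *ᵥ fun j : Fin (k + 1) => q j) = μ * ∑ i, w i * q i := by
    rw [dotProduct_mulVec, ← mulVec_transpose,
      show Tᵀ = T from (conjTranspose_eq_transpose_of_trivial T).symm.trans
        (isHermitian_tridiag k _ _), hw, smul_dotProduct, smul_eq_mul]
    rfl
  have : u * ∑ i, w i * q i = μ * ∑ i, w i * q i +
      w (Fin.last k) * (a k * q (k + 1) + θ * q k) := by
    rw [← hsymm, Finset.mul_sum, dotProduct]
    simp only [mul_left_comm u, hrow, mul_add, Finset.sum_add_distrib, mul_ite, mul_zero,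
      Finset.sum_ite_eq', Finset.mem_univ, if_true]
  linear_combination this

lemma eval_projZonal_self_congr (hn : 3 ≤ n) {x y : Fin n → ℝ} (hx : ∑ i, x i ^ 2 = 1)
    (hy : ∑ i, y i ^ 2 = 1) (l : ℕ) :
    eval x (projZonal a x l) = eval y (projZonal a y l) := by
  have : ∀ m, eval x (zonal x m) = eval y (zonal y m) := by
    intro m
    induction m with
    | zero => simp [zonal]
    | succ m ih => rw [eval_zonal_succ_self hn hx, eval_zonal_succ_self hn hy, ih]
  simp only [projZonal, map_mul, eval_C, this]

lemma eval_multiplier {x y : Fin n → ℝ} (hx : ∑ i, x i ^ 2 = 1) (hy : ∑ i, y i ^ 2 = 1) :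
    eval y (multiplier x) = n / 2 * (∑ i, x i * y i) ^ 2 - 1 / 2 := by
  simp [multiplier, eval_lin, eval_normSqPoly, hx, hy]

lemma eval_multiplier_mul_zero (h : IsProjJacobi n a b) {x y : Fin n → ℝ}
    (hx : ∑ i, x i ^ 2 = 1) (hy : ∑ i, y i ^ 2 = 1) :
    eval y (multiplier x) * eval y (projZonal a x 0) =
      a 0 * eval y (projZonal a x 1) + b 0 * eval y (projZonal a x 0) := by
  rw [← map_mul, multiplier_mul_projZonal_zero h]
  simp only [map_add, map_mul, eval_C, eval_normSqPoly, hx, hy, mul_one]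

lemma eval_multiplier_mul_succ (h : IsProjJacobi n a b) {x y : Fin n → ℝ}
    (hx : ∑ i, x i ^ 2 = 1) (hy : ∑ i, y i ^ 2 = 1) (l : ℕ) :
    eval y (multiplier x) * eval y (projZonal a x (l + 1)) =
      a (l + 1) * eval y (projZonal a x (l + 2)) + b (l + 1) * eval y (projZonal a x (l + 1)) +
        a l * eval y (projZonal a x l) := by
  rw [← map_mul, multiplier_mul_projZonal_succ h]
  simp only [map_add, map_mul, map_pow, eval_C, eval_normSqPoly, hx, hy, mul_one, one_pow]

lemma mul_card_sq_le_sum (hn : 3 ≤ n) (h : IsProjJacobi n a b) {ι : Type*} (S : Finset ι)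
    (v : ι → Fin n → ℝ) (hv : ∀ i ∈ S, ∑ j, v i j ^ 2 = 1) {k : ℕ} {θ : ℝ} (hθ : 0 ≤ θ)
    {w : Fin (k + 1) → ℝ} (hw : 0 ≤ w) :
    θ * w (Fin.last k) ^ 2 * (S.card : ℝ) ^ 2 ≤
      ∑ i ∈ S, ∑ j ∈ S, (∑ l, w l * eval (v j) (projZonal a (v i) l)) *
        (w (Fin.last k) * (a k * eval (v j) (projZonal a (v i) (k + 1)) +
          θ * eval (v j) (projZonal a (v i) k))) := by
  have e : ∑ i ∈ S, ∑ j ∈ S, (∑ l, w l * eval (v j) (projZonal a (v i) l)) *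
        (w (Fin.last k) * (a k * eval (v j) (projZonal a (v i) (k + 1)) +
          θ * eval (v j) (projZonal a (v i) k))) =
      ∑ l, (w l * w (Fin.last k) * a k * (∑ i ∈ S, ∑ j ∈ S,
          eval (v j) (projZonal a (v i) l) * eval (v j) (projZonal a (v i) (k + 1))) +
        w l * w (Fin.last k) * θ * ∑ i ∈ S, ∑ j ∈ S,
          eval (v j) (projZonal a (v i) l) * eval (v j) (projZonal a (v i) k)) := by
    simp only [Finset.sum_mul, Finset.mul_sum, ← Finset.sum_add_distrib]
    rw [Finset.sum_congr rfl fun i _ => Finset.sum_comm, Finset.sum_comm]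
    exact Finset.sum_congr rfl fun l _ => Finset.sum_congr rfl fun i _ =>
      Finset.sum_congr rfl fun j _ => by ring
  rw [e]
  have hnn : ∀ l : Fin (k + 1), 0 ≤ w l * w (Fin.last k) * a k * (∑ i ∈ S, ∑ j ∈ S,
      eval (v j) (projZonal a (v i) l) * eval (v j) (projZonal a (v i) (k + 1))) := fun l =>
    mul_nonneg (mul_nonneg (mul_nonneg (hw l) (hw _)) (h.pos k).le)
      (sum_mul_projZonal_nonneg hn h S v l (k + 1))
  have hnn' : ∀ l : Fin (k + 1), 0 ≤ w l * w (Fin.last k) * θ * (∑ i ∈ S, ∑ j ∈ S,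
      eval (v j) (projZonal a (v i) l) * eval (v j) (projZonal a (v i) k)) := fun l =>
    mul_nonneg (mul_nonneg (mul_nonneg (hw l) (hw _)) hθ)
      (sum_mul_projZonal_nonneg hn h S v l k)
  refine le_trans ?_ (Finset.single_le_sum (fun l _ => add_nonneg (hnn l) (hnn' l))
    (Finset.mem_univ (Fin.last k)))
  refine le_trans ?_ (le_add_of_nonneg_left (hnn _))
  have := mul_le_mul_of_nonneg_left (card_sq_le_sum_projZonal_sq hn h S v hv k)
    (mul_nonneg hθ (sq_nonneg (w (Fin.last k))))
  simp only [Fin.val_last, ← sq]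
  rwa [mul_comm (w (Fin.last k) ^ 2)]

lemma card_le_spectral (hn : 3 ≤ n) (h : IsProjJacobi n a b) {ι : Type*} (S : Finset ι)
    (v : ι → Fin n → ℝ) (hv : ∀ i ∈ S, ∑ j, v i j ^ 2 = 1) (k : ℕ)
    (hsep : ∀ i ∈ S, ∀ j ∈ S, i ≠ j →
      n / 2 * (∑ l, v i l * v j l) ^ 2 - 1 / 2 ≤ maxEig (Tridiag k b a))
    (hlt : maxEig (Tridiag (k + 1) b a) < (n - 1) / 2) {i₀ : ι} (hi₀ : i₀ ∈ S) :
    (S.card : ℝ) ≤ 4 * (a (k + 1) * eval (v i₀) (projZonal a (v i₀) (k + 1)) *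
      eval (v i₀) (projZonal a (v i₀) (k + 2))) / ((n - 1) / 2 - maxEig (Tridiag (k + 1) b a)) := by
  have hP := eval_projZonal_self_pos hn h (hv i₀ hi₀) (k + 1)
  have hP' := eval_projZonal_self_pos hn h (hv i₀ hi₀) (k + 2)
  obtain ⟨P, hPdef⟩ : ∃ P, P = eval (v i₀) (projZonal a (v i₀) (k + 1)) := ⟨_, rfl⟩
  obtain ⟨P', hP'def⟩ : ∃ P', P' = eval (v i₀) (projZonal a (v i₀) (k + 2)) := ⟨_, rfl⟩
  rw [← hPdef] at hP ⊢
  rw [← hP'def] at hP' ⊢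
  have ha := h.pos (k + 1)
  obtain ⟨A, hA⟩ : ∃ A, A = a (k + 1) := ⟨_, rfl⟩
  rw [← hA] at ha ⊢
  obtain ⟨θ, hθ⟩ : ∃ θ, θ = A * P' / P := ⟨_, rfl⟩
  have hθ0 : 0 < θ := by rw [hθ]; positivity
  have hθP : θ * P = A * P' := by rw [hθ]; field_simp
  set d : ℕ → ℝ := fun i => b i - if i = k + 1 then θ else 0
  obtain ⟨w, hw0, hwk, hw⟩ := exists_perron_tridiag (k := k + 1) (d := d) h.pos
  set μ := maxEig (Tridiag (k + 1) d a)
  have hμ1 : maxEig (Tridiag k b a) ≤ μ :=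
    maxEig_tridiag_le_succ fun i hi => by simp only [d]; rw [if_neg (by omega), sub_zero]
  have hμ2 : μ ≤ maxEig (Tridiag (k + 1) b a) := tridiag_mono_maxEig fun i _ => by
    simp only [d]
    split_ifs
    · linarith
    · linarith
  have hμ : 0 < (n - 1) / 2 - μ := by linarith
  have hF : ∀ i ∈ S, ∀ j ∈ S, (eval (v j) (multiplier (v i)) - μ) *
      ∑ l, w l * eval (v j) (projZonal a (v i) l) =
      w (Fin.last _) * (a (k + 1) * eval (v j) (projZonal a (v i) (k + 1 + 1)) +
          θ * eval (v j) (projZonal a (v i) (k + 1))) := fun i hi j hj =>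
    sub_mul_sum_eigenvector (q := fun l => eval (v j) (projZonal a (v i) l))
      (eval_multiplier_mul_zero h (hv i hi) (hv j hj))
      (eval_multiplier_mul_succ h (hv i hi) (hv j hj)) hw
  have hlow := mul_card_sq_le_sum hn h S v hv hθ0.le hw0
  have hup : ∑ i ∈ S, ∑ j ∈ S, (∑ l, w l * eval (v j) (projZonal a (v i) l)) *
        (w (Fin.last _) * (a (k + 1) * eval (v j) (projZonal a (v i) (k + 1 + 1)) +
          θ * eval (v j) (projZonal a (v i) (k + 1)))) ≤
      ∑ i ∈ S, (w (Fin.last _) * (2 * (A * P'))) ^ 2 / ((n - 1) / 2 - μ) := by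
    refine Finset.sum_le_sum fun i hi => ?_
    classical
    rw [← Finset.add_sum_erase S _ hi]
    have hoff : ∑ j ∈ S.erase i, (∑ l, w l * eval (v j) (projZonal a (v i) l)) *
        (w (Fin.last _) * (a (k + 1) * eval (v j) (projZonal a (v i) (k + 1 + 1)) +
          θ * eval (v j) (projZonal a (v i) (k + 1)))) ≤ 0 := by
      refine Finset.sum_nonpos fun j hj => ?_
      obtain ⟨hji, hj⟩ := Finset.mem_erase.1 hj
      rw [← hF i hi j hj, mul_left_comm]
      refine mul_nonpos_of_nonpos_of_nonneg ?_ (mul_self_nonneg _)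
      rw [eval_multiplier (hv i hi) (hv j hj)]
      linarith [hsep i hi j hj hji.symm]
    have hdiag : (∑ l, w l * eval (v i) (projZonal a (v i) l)) *
        (w (Fin.last _) * (a (k + 1) * eval (v i) (projZonal a (v i) (k + 1 + 1)) +
          θ * eval (v i) (projZonal a (v i) (k + 1)))) =
        (w (Fin.last _) * (2 * (A * P'))) ^ 2 / ((n - 1) / 2 - μ) := by
      have e := hF i hi i hi
      rw [eval_multiplier (hv i hi) (hv i hi)] at e
      simp only [← sq, hv i hi] at e
      rw [eval_projZonal_self_congr hn (hv i hi) (hv i₀ hi₀) (k + 1),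
        eval_projZonal_self_congr hn (hv i hi) (hv i₀ hi₀) (k + 1 + 1), ← hPdef, ← hP'def,
        ← hA, hθP] at e ⊢
      rw [eq_div_iff hμ.ne']
      linear_combination (w (Fin.last _) * (A * P' + A * P')) * e
    linarith
  rw [Finset.sum_const, nsmul_eq_mul] at hup
  have hcard : (0 : ℝ) < S.card := by exact_mod_cast Finset.card_pos.2 ⟨i₀, hi₀⟩
  have hmain : θ * w (Fin.last _) ^ 2 * (S.card : ℝ) ^ 2 ≤
      S.card * ((w (Fin.last _) * (2 * (A * P'))) ^ 2 / ((n - 1) / 2 - μ)) := hlow.trans hup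
  have hcμ : (S.card : ℝ) ≤ 4 * (A * P * P') / ((n - 1) / 2 - μ) := by
    refine le_of_mul_le_mul_left (hmain.trans' (le_of_eq ?_) |>.trans (le_of_eq ?_))
      (show 0 < θ * w (Fin.last _) ^ 2 * S.card by positivity)
    · ring
    · rw [mul_div_assoc', mul_div_assoc']
      congr 1
      linear_combination (-4 * w (Fin.last _) ^ 2 * S.card * A * P') * hθP
  refine hcμ.trans (div_le_div_of_nonneg_left (by positivity) (by linarith) (by linarith))

end SpectralBound

end ProjectiveCode

/-- Theorem 6: the spectral bound for codes in the real projective space `ℙℝ^{n-1}`,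
via Jacobi polynomials with `α = (n−3)/2`, `β = −1/2`. -/
theorem projective_code_spectral_bound (n : ℕ) (hn : 3 ≤ n)
    (α β : ℝ) (hα : α = ((n : ℝ) - 3) / 2) (hβ : β = -(1 / 2))
    (k : ℕ) (hk : 1 ≤ k) (t : ℝ) (ht0 : 0 < t) (ht1 : t < 1)
    (aJ bJ : ℕ → ℝ)
    (haJ : aJ = fun l : ℕ => ((α + β + 2) / (2 * l + α + β + 2))
      * Real.sqrt (((l : ℝ) + α + 1) * ((l : ℝ) + β + 1) * ((l : ℝ) + 1) * ((l : ℝ) + α + β + 1)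
        / ((2 * l + α + β + 3) * (2 * l + α + β + 1))))
    (hbJ : bJ = fun l : ℕ => 2 * (α - β) * (l : ℝ) * ((l : ℝ) + α + β + 1)
      / ((2 * (l : ℝ) + α + β) * (2 * (l : ℝ) + α + β + 2)))
    (hcond1 : (α + β + 2) * t ^ 2 - β - 1 ≤ maxEig (Tridiag (k - 1) bJ aJ))
    (hcond2 : maxEig (Tridiag k bJ aJ) < α + 1)
    (C : Finset (EuclideanSpace ℝ (Fin n)))
    (hunit : ∀ x ∈ C, ‖x‖ = 1)
    (hangle : ∀ x ∈ C, ∀ y ∈ C, x ≠ y → |⟪x, y⟫| ≤ t) :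
    (C.card : ℝ)
      ≤ (4 * (α + β + 2) * ((k : ℝ) + α + 1) / (2 * (k : ℝ) + α + β + 2))
        * genBinom ((k : ℝ) + α) α * genBinom ((k : ℝ) + α + β + 1) (k : ℝ)
        / genBinom ((k : ℝ) + β) β / (α + 1 - maxEig (Tridiag k bJ aJ)) := by
  classical
  obtain ⟨k, rfl⟩ : ∃ j, k = j + 1 := ⟨k - 1, by omega⟩
  have h := ProjectiveCode.isProjJacobi_of_eq hn hα hβ haJ hbJ
  have hn' : (3 : ℝ) ≤ n := by exact_mod_cast hn
  have hU : α + 1 = ((n : ℝ) - 1) / 2 := by rw [hα]; ring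
  have hN : α + β + 2 = (n : ℝ) / 2 := by rw [hα, hβ]; ring
  have hv : ∀ x ∈ C, ∑ j, x j ^ 2 = 1 := fun x hx => by
    rw [← EuclideanSpace.real_norm_sq_eq, hunit x hx, one_pow]
  have hsep : ∀ x ∈ C, ∀ y ∈ C, x ≠ y →
      (n : ℝ) / 2 * (∑ l, x l * y l) ^ 2 - 1 / 2 ≤ maxEig (Tridiag k bJ aJ) := by
    intro x hx y hy hxy
    rw [show ∑ l, x l * y l = ⟪x, y⟫ by
      rw [PiLp.inner_apply]; exact Finset.sum_congr rfl fun l _ => mul_comm _ _]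
    have h1 : ⟪x, y⟫ ^ 2 ≤ t ^ 2 := sq_le_sq' (abs_le.1 (hangle x hx y hy hxy)).1
      (abs_le.1 (hangle x hx y hy hxy)).2
    have h2 := mul_le_mul_of_nonneg_left h1 (show (0 : ℝ) ≤ n / 2 by positivity)
    rw [hN, hβ, Nat.add_sub_cancel] at hcond1
    linarith
  rcases C.eq_empty_or_nonempty with rfl | ⟨x₀, hx₀⟩
  · have hx : ∑ i, (Pi.single ⟨0, by omega⟩ (1 : ℝ) : Fin n → ℝ) i ^ 2 = 1 := by
      simp [Pi.single_apply]
    have hval := ProjectiveCode.mul_eval_projZonal_self_eq_genBinom hn hα hβ h hx (k + 1)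
    have hpos := mul_pos (mul_pos (h.pos (k + 1))
      (ProjectiveCode.eval_projZonal_self_pos hn h hx (k + 1)))
      (ProjectiveCode.eval_projZonal_self_pos hn h hx (k + 2))
    rw [hval] at hpos
    rw [Finset.card_empty, Nat.cast_zero]
    refine div_nonneg ?_ (by linarith)
    linear_combination 4 * hpos
  · have hval := ProjectiveCode.mul_eval_projZonal_self_eq_genBinom hn hα hβ h (hv x₀ hx₀) (k + 1)
    refine (ProjectiveCode.card_le_spectral hn h C (fun x => x) hv k hsep (hU ▸ hcond2) hx₀).trans
      (le_of_eq ?_)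
    rw [hval, hU]
    ring
end

section
/- Fix real numbers a > 0 and b ≥ 0. For each positive integer k set α = a·k and β = b·k, and let S_k be the (k+1)×(k+1) symmetric tridiagonal matrix with diagonal entries b_l = 2(α−β)·l·(l+α+β+1)/((2l+α+β)(2l+α+β+2)) for l = 0,…,k and off-diagonal entries a_l = [(α+β+2)/(2l+α+β+2)]·√((l+α+1)(l+β+1)(l+1)(l+α+β+1)/((2l+α+β+3)(2l+α+β+1))) for l = 0,…,k−1. Then λmax(S_k)/k → 2·((a+b)·√((a+1)(b+1)(a+b+1)) + (a−b)(a+b+1)) / (a+b+2)² as k → ∞. -/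
open Filter

/-- A Gershgorin bound for the eigenvalues of a tridiagonal matrix. -/
lemma tridiag_hasEigenvalue_le {k : ℕ} {d o C : ℕ → ℝ} {B μ : ℝ}
    (hC : ∀ i ≤ k, 0 ≤ C i) (ho : ∀ i < k, |o i| ≤ C i) (ho' : ∀ i < k, |o i| ≤ C (i + 1))
    (hB : ∀ i ≤ k, d i + 2 * C i ≤ B)
    (hμ : Module.End.HasEigenvalue (Matrix.toLin' (Tridiag k d o)) μ) : μ ≤ B := by
  obtain ⟨i, hi⟩ := eigenvalue_mem_ball hμ
  rw [Metric.mem_closedBall, Real.dist_eq] at hi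
  have hik : (i : ℕ) ≤ k := Nat.lt_succ_iff.mp i.2
  have hcard : ∀ p : Fin (k + 1) → Prop, ∀ [DecidablePred p], (∀ x y, p x → p y → x = y) →
      ∑ j, (if p j then C i else 0) ≤ C i := by
    intro p _ hp
    rw [← Finset.sum_filter, Finset.sum_const, nsmul_eq_mul]
    have : (Finset.univ.filter p).card ≤ 1 := by
      rw [Finset.card_le_one]
      intro x hx y hy
      exact hp x y (by simpa using hx) (by simpa using hy)
    have h1 : ((Finset.univ.filter p).card : ℝ) ≤ 1 := by exact_mod_cast this
    nlinarith [hC i hik]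
  have hsum : ∑ j ∈ Finset.univ.erase i, ‖Tridiag k d o i j‖ ≤ 2 * C i := by
    calc ∑ j ∈ Finset.univ.erase i, ‖Tridiag k d o i j‖
        ≤ ∑ j ∈ Finset.univ.erase i, ((if (i : ℕ) + 1 = (j : ℕ) then C i else 0)
            + if (j : ℕ) + 1 = (i : ℕ) then C i else 0) := by
          refine Finset.sum_le_sum fun j hj => ?_
          have hne : (i : ℕ) ≠ j := fun h => Finset.ne_of_mem_erase hj (Fin.ext h.symm)
          have hjk := j.2
          simp only [Tridiag, Matrix.of_apply, if_neg hne, Real.norm_eq_abs]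
          by_cases h1 : (i : ℕ) + 1 = j
          · have h2 : ¬ (j : ℕ) + 1 = i := by omega
            simp only [if_pos h1, if_neg h2, add_zero]
            exact ho i (by omega)
          · by_cases h2 : (j : ℕ) + 1 = i
            · simp only [if_neg h1, if_pos h2, zero_add]
              have := ho' j (by omega)
              rwa [h2] at this
            · simp [h1, h2]
      _ ≤ ∑ j : Fin (k + 1), ((if (i : ℕ) + 1 = (j : ℕ) then C i else 0)
            + if (j : ℕ) + 1 = (i : ℕ) then C i else 0) := by
          refine Finset.sum_le_sum_of_subset_of_nonneg (Finset.erase_subset _ _) fun j _ _ => ?_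
          have := hC i hik
          positivity
      _ ≤ 2 * C i := by
          rw [Finset.sum_add_distrib, two_mul]
          refine add_le_add (hcard _ fun x y hx hy => Fin.ext (by omega))
            (hcard _ fun x y hx hy => Fin.ext (by omega))
  have hdiag : Tridiag k d o i i = d i := by simp [Tridiag]
  rw [hdiag] at hi
  linarith [le_abs_self (μ - d i), hB i hik]

lemma tridiag_isHermitian (k : ℕ) (d o : ℕ → ℝ) : (Tridiag k d o).IsHermitian := by
  ext i j
  simp only [Matrix.conjTranspose_apply, star_trivial, Tridiag, Matrix.of_apply]
  split_ifs <;> first | rfl | omega | simp_all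

lemma bddAbove_setOf_hasEigenvalue {m : ℕ} (M : Matrix (Fin m) (Fin m) ℝ) :
    BddAbove {μ : ℝ | Module.End.HasEigenvalue (Matrix.toLin' M) μ} :=
  (Module.End.finite_hasEigenvalue (Matrix.toLin' M)).bddAbove

lemma hasEigenvalue_eigenvalues {m : ℕ} {M : Matrix (Fin m) (Fin m) ℝ} (hM : M.IsHermitian)
    (i : Fin m) : Module.End.HasEigenvalue (Matrix.toLin' M) (hM.eigenvalues i) := by
  refine Module.End.hasEigenvalue_of_hasEigenvector (x := (hM.eigenvectorBasis i).ofLp) ⟨?_, ?_⟩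
  · rw [Module.End.mem_eigenspace_iff, Matrix.toLin'_apply]
    exact hM.mulVec_eigenvectorBasis i
  · intro h
    exact hM.eigenvectorBasis.orthonormal.ne_zero i (by ext j; simpa using congrFun h j)

/-- The Rayleigh quotient bound for the largest eigenvalue of a symmetric matrix. -/
lemma dotProduct_mulVec_le_maxEig {m : ℕ} {M : Matrix (Fin m) (Fin m) ℝ} (hM : M.IsHermitian)
    (v : Fin m → ℝ) : v ⬝ᵥ (M.mulVec v) ≤ maxEig M * (v ⬝ᵥ v) := by
  have hA : (maxEig M • (1 : Matrix (Fin m) (Fin m) ℝ) - M).IsHermitian :=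
    (Matrix.isHermitian_one.smul (by simp [IsSelfAdjoint])).sub hM
  have hps : (maxEig M • (1 : Matrix (Fin m) (Fin m) ℝ) - M).PosSemidef := by
    rw [hA.posSemidef_iff_eigenvalues_nonneg]
    intro i
    have h := (hasEigenvalue_eigenvalues hA i).exists_hasEigenvector
    obtain ⟨w, hw, hw0⟩ := h
    rw [Module.End.mem_eigenspace_iff, Matrix.toLin'_apply, Matrix.sub_mulVec,
      Matrix.smul_mulVec, Matrix.one_mulVec] at hw
    have hev : Module.End.HasEigenvalue (Matrix.toLin' M) (maxEig M - hA.eigenvalues i) := by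
      refine Module.End.hasEigenvalue_of_hasEigenvector (x := w) ⟨?_, hw0⟩
      rw [Module.End.mem_eigenspace_iff, Matrix.toLin'_apply, sub_smul, ← hw]
      abel
    have := le_csSup (bddAbove_setOf_hasEigenvalue M) hev
    change _ ≤ maxEig M at this
    simp only [Pi.zero_apply]
    linarith
  have h := hps.dotProduct_mulVec_nonneg v
  rw [star_trivial, Matrix.sub_mulVec, Matrix.smul_mulVec, Matrix.one_mulVec, dotProduct_sub,
    dotProduct_smul, smul_eq_mul] at h
  linarith

lemma tridiag_dotProduct_mulVec (k : ℕ) (d o x : ℕ → ℝ) :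
    (fun i : Fin (k + 1) => x i) ⬝ᵥ ((Tridiag k d o).mulVec fun i => x i)
      = ∑ i ∈ Finset.range (k + 1), d i * x i ^ 2
        + 2 * ∑ i ∈ Finset.range k, o i * (x i * x (i + 1)) := by
  have hup : ∑ i ∈ Finset.range (k + 1), ∑ j ∈ Finset.range (k + 1),
      (if i + 1 = j then o i * (x i * x j) else 0)
        = ∑ i ∈ Finset.range k, o i * (x i * x (i + 1)) := by
    rw [Finset.sum_range_succ]
    simp only [Finset.sum_ite_eq, Finset.mem_range, lt_self_iff_false, if_false, add_zero]
    exact Finset.sum_congr rfl fun i hi => by simp_all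
  have hlow : ∑ i ∈ Finset.range (k + 1), ∑ j ∈ Finset.range (k + 1),
      (if j + 1 = i then o j * (x j * x i) else 0)
        = ∑ i ∈ Finset.range k, o i * (x i * x (i + 1)) := by
    rw [Finset.sum_comm, hup]
  have hdiag : ∑ i ∈ Finset.range (k + 1), ∑ j ∈ Finset.range (k + 1),
      (if i = j then d i * x i ^ 2 else 0) = ∑ i ∈ Finset.range (k + 1), d i * x i ^ 2 := by
    simp only [Finset.sum_ite_eq]
    exact Finset.sum_congr rfl fun i hi => by simp_all
  rw [two_mul]
  nth_rewrite 1 [← hup]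
  rw [← hlow, ← hdiag, ← Finset.sum_add_distrib, ← Finset.sum_add_distrib,
    ← Fin.sum_univ_eq_sum_range
    (fun i => ∑ j ∈ Finset.range (k + 1), (if i = j then d i * x i ^ 2 else 0) +
      (∑ j ∈ Finset.range (k + 1), (if i + 1 = j then o i * (x i * x j) else 0)
        + ∑ j ∈ Finset.range (k + 1), (if j + 1 = i then o j * (x j * x i) else 0)))]
  refine Finset.sum_congr rfl fun i _ => ?_
  rw [← Finset.sum_add_distrib, ← Finset.sum_add_distrib, ← Fin.sum_univ_eq_sum_range (fun j =>
    (if (i : ℕ) = j then d i * x i ^ 2 else 0) + ((if (i : ℕ) + 1 = j then o i * (x i * x j) else 0)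
        + (if j + 1 = (i : ℕ) then o j * (x j * x i) else 0)))]
  simp only [Matrix.mulVec, dotProduct, Finset.mul_sum]
  refine Finset.sum_congr rfl fun j _ => ?_
  simp only [Tridiag, Matrix.of_apply]
  split_ifs with h1 h2 h3 h4 h5 h6 <;> first | omega | skip
  all_goals simp_all
  all_goals ring

/-- Testing the quadratic form on the indicator of the last `n + 1` indices. -/
lemma sum_le_maxEig_tridiag {k n : ℕ} (hn : n ≤ k) (d o : ℕ → ℝ) :
    ∑ j ∈ Finset.range (n + 1), d (k - j) + 2 * ∑ j ∈ Finset.range n, o (k - 1 - j)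
      ≤ maxEig (Tridiag k d o) * (n + 1) := by
  set x : ℕ → ℝ := fun l => if k ≤ l + n then 1 else 0 with hx
  have key : ∀ f : ℕ → ℝ, ∑ i ∈ Finset.range (k + 1), f i * x i ^ 2
      = ∑ j ∈ Finset.range (n + 1), f (k - j) := by
    intro f
    rw [← Finset.sum_range_reflect]
    symm
    refine Finset.sum_subset_zero_on_sdiff (by simpa using hn) ?_ ?_
    · intro j hj
      simp only [Finset.mem_sdiff, Finset.mem_range] at hj
      have : ¬ k ≤ k - j + n := by omega
      simp [hx, this]
    · intro j hj
      simp only [Finset.mem_range] at hj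
      have : k ≤ k - j + n := by omega
      simp [hx, this]
  have key' : ∑ i ∈ Finset.range k, o i * (x i * x (i + 1))
      = ∑ j ∈ Finset.range n, o (k - 1 - j) := by
    rw [← Finset.sum_range_reflect]
    symm
    refine Finset.sum_subset_zero_on_sdiff (by simpa using hn) ?_ ?_
    · intro j hj
      simp only [Finset.mem_sdiff, Finset.mem_range] at hj
      have : ¬ k ≤ k - 1 - j + n := by omega
      simp [hx, this]
    · intro j hj
      simp only [Finset.mem_range] at hj
      have h1 : k ≤ k - 1 - j + n := by omega
      have h2 : k ≤ k - 1 - j + 1 + n := by omega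
      simp [hx, h1, h2]
  have h := dotProduct_mulVec_le_maxEig (tridiag_isHermitian k d o) (fun i => x i)
  rw [tridiag_dotProduct_mulVec, key, key'] at h
  have hnorm : (fun i : Fin (k + 1) => x i) ⬝ᵥ (fun i => x i) = n + 1 := by
    rw [dotProduct, Fin.sum_univ_eq_sum_range (fun i => x i * x i)]
    have := key fun _ => 1
    simp only [one_mul, Finset.sum_const, Finset.card_range, nsmul_eq_mul, mul_one] at this
    simpa [sq] using this
  rwa [hnorm] at h

/-- If the entries of a tridiagonal matrix of size `k + 1` are `k` times a continuous profile in
`(l / k, 1 / k)` and the limiting profile is largest at the right end, then so is the largest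
eigenvalue, to leading order. -/
theorem tendsto_maxEig_tridiag {F G : ℝ × ℝ → ℝ}
    (hF : ContinuousOn F (Set.Icc 0 1 ×ˢ Set.Icc 0 1))
    (hG : ContinuousOn G (Set.Icc 0 1 ×ˢ Set.Icc 0 1))
    (hF0 : ∀ z ∈ Set.Icc (0 : ℝ) 1 ×ˢ Set.Icc (0 : ℝ) 1, 0 ≤ F z)
    (hmax : ∀ x ∈ Set.Icc (0 : ℝ) 1, G (x, 0) + 2 * F (x, 0) ≤ G (1, 0) + 2 * F (1, 0)) :
    Tendsto (fun k : ℕ => maxEig (Tridiag k (fun l => k * G (l / k, 1 / k))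
      (fun l => k * F (l / k, 1 / k))) / (k : ℝ)) atTop (nhds (G (1, 0) + 2 * F (1, 0))) := by
  have hmem : ∀ {k l : ℕ}, 0 < k → l ≤ k →
      (((l : ℝ) / k, 1 / (k : ℝ)) : ℝ × ℝ) ∈ Set.Icc (0 : ℝ) 1 ×ˢ Set.Icc (0 : ℝ) 1 := by
    intro k l hk hl
    have hk' : (1 : ℝ) ≤ k := by exact_mod_cast hk
    have hl' : (l : ℝ) ≤ k := by exact_mod_cast hl
    refine ⟨⟨by positivity, ?_⟩, ⟨by positivity, ?_⟩⟩
    · exact (div_le_one (by positivity)).2 hl'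
    · exact (div_le_one (by positivity)).2 hk'
  rw [tendsto_order]
  constructor
  · intro c hc
    have hlim : ∀ H : ℝ × ℝ → ℝ, ContinuousOn H (Set.Icc 0 1 ×ˢ Set.Icc 0 1) → ∀ j : ℕ,
        Tendsto (fun k : ℕ => H (((k - j : ℕ) : ℝ) / k, 1 / (k : ℝ))) atTop (nhds (H (1, 0))) := by
      intro H hH j
      have h1 := hH (1, 0) (by simp)
      refine h1.tendsto.comp (tendsto_nhdsWithin_iff.2 ⟨?_, ?_⟩)
      · refine Tendsto.prodMk_nhds ?_ tendsto_one_div_atTop_nhds_zero_nat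
        have h2 : Tendsto (fun k : ℕ => 1 - (j : ℝ) / k) atTop (nhds (1 - 0)) :=
          tendsto_const_nhds.sub (tendsto_const_div_atTop_nhds_zero_nat _)
        rw [sub_zero] at h2
        refine h2.congr' ?_
        filter_upwards [eventually_ge_atTop (j + 1)] with k hk
        have : (k : ℝ) ≠ 0 := by
          have : k ≠ 0 := by omega
          exact_mod_cast this
        rw [Nat.cast_sub (by omega)]
        field_simp
      · filter_upwards [eventually_gt_atTop 0] with k hk
        exact hmem hk (Nat.sub_le _ _)
    obtain ⟨n, hn⟩ : ∃ n : ℕ, c * (n + 1) < (n + 1) * G (1, 0) + 2 * (n * F (1, 0)) := by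
      obtain ⟨n, hn⟩ := exists_nat_gt (2 * F (1, 0) / (G (1, 0) + 2 * F (1, 0) - c))
      rw [div_lt_iff₀ (by linarith)] at hn
      exact ⟨n, by nlinarith⟩
    have hsum : Tendsto (fun k : ℕ => ∑ j ∈ Finset.range (n + 1), G (((k - j : ℕ) : ℝ) / k, 1 / (k : ℝ))
        + 2 * ∑ j ∈ Finset.range n, F (((k - 1 - j : ℕ) : ℝ) / k, 1 / (k : ℝ))) atTop
        (nhds ((n + 1) * G (1, 0) + 2 * (n * F (1, 0)))) := by
      have h1 := tendsto_finsetSum (Finset.range (n + 1)) fun j _ => hlim G hG j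
      have h2 := tendsto_finsetSum (Finset.range n) fun j _ => hlim F hF (1 + j)
      have h3 := h1.add (h2.const_mul 2)
      simpa [Nat.sub_sub] using h3
    filter_upwards [hsum.eventually_const_lt hn, eventually_ge_atTop (n + 1)] with k hk hnk
    have hk0 : (0 : ℝ) < k := by
      have : 0 < k := by omega
      exact_mod_cast this
    have h := sum_le_maxEig_tridiag (k := k) (n := n) (by omega)
      (fun l => k * G (l / k, 1 / k)) (fun l => k * F (l / k, 1 / k))
    simp only [← Finset.mul_sum] at h
    rw [lt_div_iff₀ hk0]
    have hn1 : (0 : ℝ) < n + 1 := by positivity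
    refine lt_of_mul_lt_mul_right (lt_of_lt_of_le ?_ h) hn1.le
    have := mul_lt_mul_of_pos_left hk hk0
    linarith
  · intro c hc
    set L := G (1, 0) + 2 * F (1, 0) with hL
    set ε := (c - L) / 6 with hε
    have hε0 : 0 < ε := by rw [hε]; linarith
    have huF := (isCompact_Icc.prod isCompact_Icc).uniformContinuousOn_of_continuous hF
    have huG := (isCompact_Icc.prod isCompact_Icc).uniformContinuousOn_of_continuous hG
    rw [Metric.uniformContinuousOn_iff] at huF huG
    obtain ⟨δ₁, hδ₁, huF⟩ := huF ε hε0
    obtain ⟨δ₂, hδ₂, huG⟩ := huG ε hε0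
    filter_upwards [eventually_gt_atTop 0, (tendsto_one_div_atTop_nhds_zero_nat (𝕜 := ℝ)).eventually_lt_const
      hδ₁, (tendsto_one_div_atTop_nhds_zero_nat (𝕜 := ℝ)).eventually_lt_const hδ₂] with k hk h1 h2
    have hk0 : (0 : ℝ) < k := by exact_mod_cast hk
    have hx : ∀ l ≤ k, (((l : ℝ) / k, (0 : ℝ)) : ℝ × ℝ) ∈ Set.Icc (0 : ℝ) 1 ×ˢ Set.Icc (0 : ℝ) 1 :=
      fun l hl => ⟨(hmem hk hl).1, by simp⟩
    have hFle : ∀ l m : ℕ, l ≤ k → m ≤ k → |(l : ℝ) - m| ≤ 1 →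
        F (l / k, 1 / k) ≤ F (m / k, 0) + ε := by
      intro l m hl hm hlm
      have := huF _ (hmem hk hl) _ (hx m hm) (by
        rw [Prod.dist_eq, Real.dist_eq, Real.dist_eq, sub_zero, ← sub_div, abs_div,
          abs_of_pos hk0, abs_of_pos (by positivity : (0 : ℝ) < 1 / k)]
        exact max_lt (lt_of_le_of_lt (by gcongr) h1) h1)
      rw [Real.dist_eq] at this
      linarith [le_abs_self (F (l / k, 1 / k) - F (m / k, 0))]
    have hGle : ∀ l : ℕ, l ≤ k → G (l / k, 1 / k) ≤ G (l / k, 0) + ε := by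
      intro l hl
      have := huG _ (hmem hk hl) _ (hx l hl) (by
        rw [Prod.dist_eq, Real.dist_eq, Real.dist_eq, sub_zero, sub_self, abs_zero,
          abs_of_pos (by positivity : (0 : ℝ) < 1 / k)]
        exact max_lt hδ₂ h2)
      rw [Real.dist_eq] at this
      linarith [le_abs_self (G (l / k, 1 / k) - G (l / k, 0))]
    have hle : maxEig (Tridiag k (fun l => k * G (l / k, 1 / k)) (fun l => k * F (l / k, 1 / k)))
        ≤ k * (L + 3 * ε) := by
      refine csSup_le ⟨_, hasEigenvalue_eigenvalues (tridiag_isHermitian k _ _) 0⟩ fun μ hμ => ?_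
      refine tridiag_hasEigenvalue_le (C := fun l => k * (F (l / k, 0) + ε)) ?_ ?_ ?_ ?_ hμ
      · intro i hi
        have := hF0 _ (hx i hi)
        positivity
      · intro i hi
        have := hF0 _ (hmem hk hi.le)
        rw [abs_of_nonneg (by positivity)]
        exact mul_le_mul_of_nonneg_left (hFle i i hi.le hi.le (by simp)) hk0.le
      · intro i hi
        have := hF0 _ (hmem hk hi.le)
        rw [abs_of_nonneg (by positivity)]
        exact mul_le_mul_of_nonneg_left (hFle i (i + 1) hi.le hi (by simp)) hk0.le
      · intro i hi
        have h3 := hGle i hi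
        have h4 := hmax _ (hx i hi).1
        have : k * (G (i / k, 1 / k) + 2 * (F (i / k, 0) + ε)) ≤ k * (L + 3 * ε) :=
          mul_le_mul_of_nonneg_left (by linarith) hk0.le
        linarith
    rw [div_lt_iff₀ hk0]
    refine hle.trans_lt ?_
    rw [mul_comm]
    exact mul_lt_mul_of_pos_right (by rw [hε]; linarith) hk0

lemma quadratic_form_mono {c d K p₁ q₁ p₂ q₂ : ℝ} (hc : 0 < c) (hK : d < 0 → 0 < K)
    (hp₂ : 0 ≤ p₂) (hq₂ : 0 ≤ q₂) (hp : p₂ ≤ p₁) (hq : q₂ ≤ q₁) (hpq : p₂ * q₁ ≤ p₁ * q₂)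
    (h₁ : c ^ 2 * q₁ ^ 2 - d ^ 2 * p₁ ^ 2 = K) (h₂ : c ^ 2 * q₂ ^ 2 - d ^ 2 * p₂ ^ 2 = K) :
    d * p₂ ^ 2 + c * (p₂ * q₂) ≤ d * p₁ ^ 2 + c * (p₁ * q₁) := by
  rcases le_or_gt 0 d with hd | hd
  · have := hp₂.trans hp
    gcongr
  · have hK := hK hd
    have hq₂' : 0 < q₂ := by
      refine lt_of_le_of_ne hq₂ fun h => ?_
      rw [← h] at h₂
      nlinarith [sq_nonneg (d * p₂)]
    have hq₁ := hq₂'.trans_le hq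
    have hp₁ := hp₂.trans hp
    have hD₁ : 0 < c * q₁ - d * p₁ := by nlinarith [mul_pos hc hq₁]
    have hD₂ : 0 < c * q₂ - d * p₂ := by nlinarith [mul_pos hc hq₂']
    have e₁ : d * p₁ ^ 2 + c * (p₁ * q₁) = p₁ * K / (c * q₁ - d * p₁) := by
      rw [eq_div_iff hD₁.ne', ← h₁]; ring
    have e₂ : d * p₂ ^ 2 + c * (p₂ * q₂) = p₂ * K / (c * q₂ - d * p₂) := by
      rw [eq_div_iff hD₂.ne', ← h₂]; ring
    rw [e₁, e₂, div_le_div_iff₀ hD₂ hD₁]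
    nlinarith [mul_le_mul_of_nonneg_left hpq (mul_pos hK hc).le]

lemma jacobi_profile_mono {a b x y : ℝ} (ha : 0 < a) (hb : 0 ≤ b) (hx : 0 ≤ x) (hxy : x ≤ y) :
    (a - b) * (x * (x + (a + b)) / (2 * x + (a + b)) ^ 2) + (a + b) *
        (Real.sqrt (x * (x + (a + b))) / (2 * x + (a + b))
          * (Real.sqrt ((x + a) * (x + b)) / (2 * x + (a + b))))
      ≤ (a - b) * (y * (y + (a + b)) / (2 * y + (a + b)) ^ 2) + (a + b) *
        (Real.sqrt (y * (y + (a + b))) / (2 * y + (a + b))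
          * (Real.sqrt ((y + a) * (y + b)) / (2 * y + (a + b)))) := by
  have hy : 0 ≤ y := hx.trans hxy
  have hsq : ∀ t : ℝ, 0 ≤ t → t * (t + (a + b)) / (2 * t + (a + b)) ^ 2
      = (Real.sqrt (t * (t + (a + b))) / (2 * t + (a + b))) ^ 2 := fun t ht => by
    rw [div_pow, Real.sq_sqrt (by positivity)]
  have hX : x * (x + (a + b)) ≤ y * (y + (a + b)) := by gcongr
  have hX0 : 0 ≤ x * (x + (a + b)) := by positivity
  rw [hsq x hx, hsq y hy]
  have hsx : (2 * x + (a + b)) ^ 2 = 4 * (x * (x + (a + b))) + (a + b) ^ 2 := by ring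
  have hsy : (2 * y + (a + b)) ^ 2 = 4 * (y * (y + (a + b))) + (a + b) ^ 2 := by ring
  have hK : ∀ t : ℝ, 0 ≤ t →
      (a + b) ^ 2 * (Real.sqrt ((t + a) * (t + b)) / (2 * t + (a + b))) ^ 2
        - (a - b) ^ 2 * (Real.sqrt (t * (t + (a + b))) / (2 * t + (a + b))) ^ 2 = a * b := by
    intro t ht
    have : 2 * t + (a + b) ≠ 0 := by positivity
    rw [div_pow, div_pow, Real.sq_sqrt (by positivity), Real.sq_sqrt (by positivity)]
    field_simp
    ring
  refine quadratic_form_mono (by positivity) (fun h => mul_pos ha (by linarith))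
    (by positivity) (by positivity) ?_ ?_ ?_ (hK y hy) (hK x hx)
  · refine (pow_le_pow_iff_left₀ (by positivity) (by positivity) two_ne_zero).1 ?_
    rw [div_pow, div_pow, Real.sq_sqrt (by positivity), Real.sq_sqrt (by positivity),
      div_le_div_iff₀ (by positivity) (by positivity), hsx, hsy]
    nlinarith [mul_le_mul_of_nonneg_right hX (sq_nonneg (a + b))]
  · refine (pow_le_pow_iff_left₀ (by positivity) (by positivity) two_ne_zero).1 ?_
    rw [div_pow, div_pow, Real.sq_sqrt (by positivity), Real.sq_sqrt (by positivity),
      div_le_div_iff₀ (by positivity) (by positivity), hsx, hsy]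
    nlinarith [mul_le_mul_of_nonneg_right hX (sq_nonneg (a - b))]
  · rw [div_mul_div_comm, div_mul_div_comm, mul_comm (2 * y + (a + b))]
    refine div_le_div_of_nonneg_right ?_ (by positivity)
    rw [← Real.sqrt_mul (by positivity), ← Real.sqrt_mul (by positivity)]
    refine Real.sqrt_le_sqrt ?_
    nlinarith [mul_le_mul_of_nonneg_right hX (mul_nonneg ha.le hb)]


/-- Asymptotics of the largest eigenvalue of the Jacobi tridiagonal matrix `S_k` in the
regime `α = a·k`, `β = b·k`. -/
theorem jacobi_maxEig_limit (a b : ℝ) (ha : 0 < a) (hb : 0 ≤ b)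
    (aJ bJ : ℕ → ℕ → ℝ)
    (haJ : aJ = fun (k l : ℕ) => ((a * k + b * k + 2) / (2 * l + a * k + b * k + 2))
      * Real.sqrt (((l : ℝ) + a * k + 1) * ((l : ℝ) + b * k + 1) * ((l : ℝ) + 1)
          * ((l : ℝ) + a * k + b * k + 1)
        / ((2 * l + a * k + b * k + 3) * (2 * l + a * k + b * k + 1))))
    (hbJ : bJ = fun (k l : ℕ) => 2 * (a * k - b * k) * (l : ℝ) * ((l : ℝ) + a * k + b * k + 1)
      / ((2 * (l : ℝ) + a * k + b * k) * (2 * (l : ℝ) + a * k + b * k + 2))) :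
    Tendsto (fun k : ℕ => maxEig (Tridiag k (bJ k) (aJ k)) / (k : ℝ)) atTop
      (nhds (2 * ((a + b) * Real.sqrt ((a + 1) * (b + 1) * (a + b + 1))
          + (a - b) * (a + b + 1)) / (a + b + 2) ^ 2)) := by
  have hF : ContinuousOn (fun z : ℝ × ℝ => (a + b + 2 * z.2) / (2 * z.1 + a + b + 2 * z.2) *
      Real.sqrt ((z.1 + a + z.2) * (z.1 + b + z.2) * (z.1 + z.2) * (z.1 + a + b + z.2)
        / ((2 * z.1 + a + b + 3 * z.2) * (2 * z.1 + a + b + z.2))))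
      (Set.Icc 0 1 ×ˢ Set.Icc 0 1) := by
    refine ContinuousOn.mul (ContinuousOn.div (by fun_prop) (by fun_prop) ?_)
      (ContinuousOn.sqrt (ContinuousOn.div (by fun_prop) (by fun_prop) ?_))
    all_goals
      rintro ⟨x, h⟩ ⟨⟨hx, -⟩, ⟨hh, -⟩⟩
      dsimp only at hx hh ⊢
      positivity
  have hG : ContinuousOn (fun z : ℝ × ℝ => 2 * (a - b) * z.1 * (z.1 + a + b + z.2)
      / ((2 * z.1 + a + b) * (2 * z.1 + a + b + 2 * z.2))) (Set.Icc 0 1 ×ˢ Set.Icc 0 1) := by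
    refine ContinuousOn.div (by fun_prop) (by fun_prop) ?_
    rintro ⟨x, h⟩ ⟨⟨hx, -⟩, ⟨hh, -⟩⟩
    dsimp only at hx hh ⊢
    positivity
  have hprofile : ∀ x : ℝ, 0 ≤ x → 2 * (a - b) * x * (x + a + b + 0)
      / ((2 * x + a + b) * (2 * x + a + b + 2 * 0))
      + 2 * ((a + b + 2 * 0) / (2 * x + a + b + 2 * 0) *
        Real.sqrt ((x + a + 0) * (x + b + 0) * (x + 0) * (x + a + b + 0)
          / ((2 * x + a + b + 3 * 0) * (2 * x + a + b + 0))))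
      = 2 * ((a - b) * (x * (x + (a + b)) / (2 * x + (a + b)) ^ 2) + (a + b) *
        (Real.sqrt (x * (x + (a + b))) / (2 * x + (a + b))
          * (Real.sqrt ((x + a) * (x + b)) / (2 * x + (a + b))))) := by
    intro x hx
    have hs : 2 * x + (a + b) ≠ 0 := by positivity
    simp only [mul_zero, add_zero, add_assoc]
    rw [Real.sqrt_div (by positivity), Real.sqrt_mul_self (by positivity),
      div_mul_div_comm (Real.sqrt (x * (x + (a + b)))), ← Real.sqrt_mul (by positivity),
      show (x + a) * (x + b) * x * (x + (a + b)) = x * (x + (a + b)) * ((x + a) * (x + b)) by ring]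
    field_simp
  have key := tendsto_maxEig_tridiag hF hG ?_ ?_
  · have hlim : 2 * ((a + b) * Real.sqrt ((a + 1) * (b + 1) * (a + b + 1))
        + (a - b) * (a + b + 1)) / (a + b + 2) ^ 2
        = 2 * ((a - b) * (1 * (1 + (a + b)) / (2 * 1 + (a + b)) ^ 2) + (a + b) *
        (Real.sqrt (1 * (1 + (a + b))) / (2 * 1 + (a + b))
          * (Real.sqrt ((1 + a) * (1 + b)) / (2 * 1 + (a + b))))) := by
      rw [div_mul_div_comm, ← Real.sqrt_mul (by positivity),
        show 1 * (1 + (a + b)) * ((1 + a) * (1 + b)) = (a + 1) * (b + 1) * (a + b + 1) by ring,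
        show 2 * 1 + (a + b) = a + b + 2 by ring]
      field_simp
      ring
    rw [hlim, ← hprofile 1 zero_le_one]
    refine key.congr' ?_
    filter_upwards [eventually_gt_atTop 0] with k hk
    have hk0 : (0 : ℝ) < k := by exact_mod_cast hk
    subst haJ hbJ
    congr 3 <;> funext l <;> dsimp only
    · have : 2 * (l : ℝ) + a * k + b * k ≠ 0 := by positivity
      have : 2 * (l : ℝ) + a * k + b * k + 2 ≠ 0 := by positivity
      field_simp
    · rw [show ((l : ℝ) + a * k + 1) * ((l : ℝ) + b * k + 1) * ((l : ℝ) + 1)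
          * ((l : ℝ) + a * k + b * k + 1)
          / ((2 * l + a * k + b * k + 3) * (2 * l + a * k + b * k + 1))
          = (k : ℝ) ^ 2 * ((l / k + a + 1 / k) * (l / k + b + 1 / k) * (l / k + 1 / k)
            * (l / k + a + b + 1 / k)
            / ((2 * (l / k) + a + b + 3 * (1 / k)) * (2 * (l / k) + a + b + 1 / k))) by
          field_simp,
        Real.sqrt_mul (by positivity), Real.sqrt_sq hk0.le, ← mul_assoc, ← mul_assoc,
        mul_comm _ (k : ℝ)]
      congr 2
      field_simp
  · rintro ⟨x, h⟩ ⟨⟨hx, -⟩, ⟨hh, -⟩⟩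
    dsimp only at hx hh ⊢
    positivity
  · intro x hx
    dsimp only
    rw [hprofile x hx.1, hprofile 1 zero_le_one]
    linarith [jacobi_profile_mono ha hb hx.1 hx.2]
end

section
/- Fix t ∈ (0,1) and set s = (1/√(1−t²) − 1)/2. For every ε > 0 there exists N such that for all n ≥ N, every finite set C of unit vectors in ℝ^n satisfying |⟨x,y⟩| ≤ t for all distinct x, y ∈ C satisfies (1/n)·log₂|C| ≤ (1+s)·log₂(1+s) − s·log₂ s + ε. -/
open RealInnerProductSpace

open MvPolynomial in
/-- The degree-`k` part of the Fischer inner product on real polynomials. -/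
noncomputable def fischer {n : ℕ} (k : ℕ) (p q : MvPolynomial (Fin n) ℝ) : ℝ :=
  ∑ α ∈ Finset.univ.finsuppAntidiag k, ((∏ i, (α i).factorial : ℕ) : ℝ) * coeff α p * coeff α q

section Fischer

open MvPolynomial

variable {n : ℕ}

lemma fischer_comm (k : ℕ) (p q : MvPolynomial (Fin n) ℝ) : fischer k p q = fischer k q p :=
  Finset.sum_congr rfl fun _ _ => by ring

lemma fischer_add_left (k : ℕ) (p p' q : MvPolynomial (Fin n) ℝ) :
    fischer k (p + p') q = fischer k p q + fischer k p' q := by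
  simp only [fischer, coeff_add, mul_add, add_mul, Finset.sum_add_distrib]

lemma fischer_sum_left {ι : Type*} (s : Finset ι) (k : ℕ) (p : ι → MvPolynomial (Fin n) ℝ)
    (q : MvPolynomial (Fin n) ℝ) :
    fischer k (∑ i ∈ s, p i) q = ∑ i ∈ s, fischer k (p i) q := by
  simp only [fischer, coeff_sum, Finset.mul_sum, Finset.sum_mul]
  exact Finset.sum_comm

lemma fischer_C_mul_left (k : ℕ) (a : ℝ) (p q : MvPolynomial (Fin n) ℝ) :
    fischer k (C a * p) q = a * fischer k p q := by
  simp only [fischer, coeff_C_mul, Finset.mul_sum]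
  exact Finset.sum_congr rfl fun _ _ => by ring

lemma fischer_X_mul_left (k : ℕ) (i : Fin n) (p q : MvPolynomial (Fin n) ℝ) :
    fischer (k + 1) (X i * p) q = fischer k p (pderiv i q) := by
  symm
  refine Finset.sum_of_injOn (fun β => Finsupp.single i 1 + β)
    (fun _ _ _ _ h => add_left_cancel h) ?_ ?_ ?_
  · intro β hβ
    simp only [Finset.mem_coe, Finset.mem_finsuppAntidiag] at hβ ⊢
    refine ⟨?_, Finset.subset_univ _⟩
    simp [Finset.sum_add_distrib, Finsupp.single_apply, hβ.1, add_comm]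
  · intro α hα h
    rw [coeff_X_mul', if_neg]
    · simp
    · intro hi
      refine h ⟨α - Finsupp.single i 1, ?_, ?_⟩
      · simp only [Finset.mem_coe, Finset.mem_finsuppAntidiag] at hα ⊢
        refine ⟨?_, Finset.subset_univ _⟩
        have hle : Finsupp.single i 1 ≤ α := by
          rw [Finsupp.single_le_iff]
          exact Nat.one_le_iff_ne_zero.2 (Finsupp.mem_support_iff.1 hi)
        have : ∑ j, (Finsupp.single i 1 + (α - Finsupp.single i 1) : Fin n →₀ ℕ) j = k + 1 := by
          rw [add_tsub_cancel_of_le hle]; exact hα.1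
        simp only [Finsupp.add_apply, Finset.sum_add_distrib, Finsupp.single_apply] at this
        simp only [Finset.sum_ite_eq, Finset.mem_univ, if_true] at this
        change ∑ j, (α - Finsupp.single i 1 : Fin n →₀ ℕ) j = k
        omega
      · exact add_tsub_cancel_of_le (by
          rw [Finsupp.single_le_iff]
          exact Nat.one_le_iff_ne_zero.2 (Finsupp.mem_support_iff.1 hi))
  · intro β _
    rw [coeff_X_mul, coeff_pderiv, add_comm β]
    have : (∏ j, ((Finsupp.single i 1 + β : Fin n →₀ ℕ) j).factorial) = (β i + 1) * ∏ j, (β j).factorial := by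
      rw [← Finset.mul_prod_erase _ _ (Finset.mem_univ i),
        ← Finset.mul_prod_erase _ (fun j => (β j).factorial) (Finset.mem_univ i), ← mul_assoc]
      congr 1
      · simp [add_comm 1, Nat.factorial_succ]
      · refine Finset.prod_congr rfl fun j hj => ?_
        simp [(Finset.ne_of_mem_erase hj).symm]
    rw [this]
    push_cast
    ring

/-- The linear form `y ↦ ⟨x, y⟩`. -/
noncomputable def linForm (x : Fin n → ℝ) : MvPolynomial (Fin n) ℝ := ∑ i, C (x i) * X i

/-- The quadratic form `y ↦ ‖y‖²`. -/
noncomputable def normSqForm (n : ℕ) : MvPolynomial (Fin n) ℝ := ∑ i, X i * X i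

/-- The directional derivative along `x`. -/
noncomputable def dirDeriv (x : Fin n → ℝ) :
    Derivation ℝ (MvPolynomial (Fin n) ℝ) (MvPolynomial (Fin n) ℝ) := ∑ i, x i • pderiv i

lemma dirDeriv_apply (x : Fin n → ℝ) (p : MvPolynomial (Fin n) ℝ) :
    dirDeriv x p = ∑ i, C (x i) * pderiv i p := by
  have : ∀ s : Finset (Fin n), (∑ i ∈ s, x i • pderiv (R := ℝ) i) p =
      ∑ i ∈ s, C (x i) * pderiv i p := by
    intro s
    induction s using Finset.induction_on with
    | empty => simp
    | insert a s ha ih => rw [Finset.sum_insert ha, Finset.sum_insert ha, Derivation.add_apply, ih,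
        Derivation.smul_apply, smul_eq_C_mul]
  exact this _

/-- The Laplacian. -/
noncomputable def laplacian (p : MvPolynomial (Fin n) ℝ) : MvPolynomial (Fin n) ℝ :=
  ∑ i, pderiv i (pderiv i p)

lemma fischer_linForm_mul_left (k : ℕ) (x : Fin n → ℝ) (p q : MvPolynomial (Fin n) ℝ) :
    fischer (k + 1) (linForm x * p) q = fischer k p (dirDeriv x q) := by
  rw [linForm, Finset.sum_mul, fischer_sum_left, dirDeriv_apply, fischer_comm, fischer_sum_left]
  refine Finset.sum_congr rfl fun i _ => ?_
  rw [mul_assoc, fischer_C_mul_left, fischer_X_mul_left, fischer_C_mul_left, fischer_comm]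

lemma fischer_normSqForm_mul_left (k : ℕ) (p q : MvPolynomial (Fin n) ℝ) :
    fischer (k + 2) (normSqForm n * p) q = fischer k p (laplacian q) := by
  rw [normSqForm, Finset.sum_mul, fischer_sum_left, laplacian, fischer_comm, fischer_sum_left]
  refine Finset.sum_congr rfl fun i _ => ?_
  rw [mul_assoc, fischer_X_mul_left, fischer_X_mul_left, fischer_comm]

lemma isHomogeneous_linForm (x : Fin n → ℝ) : (linForm x).IsHomogeneous 1 :=
  IsHomogeneous.sum _ _ _ fun i _ => (isHomogeneous_X ℝ i).C_mul (x i)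

lemma isHomogeneous_normSqForm : (normSqForm n).IsHomogeneous 2 :=
  IsHomogeneous.sum _ _ _ fun i _ => (isHomogeneous_X ℝ i).mul (isHomogeneous_X ℝ i)

lemma isHomogeneous_dirDeriv (x : Fin n → ℝ) {p : MvPolynomial (Fin n) ℝ} {k : ℕ}
    (hp : p.IsHomogeneous (k + 1)) : (dirDeriv x p).IsHomogeneous k := by
  rw [dirDeriv_apply]
  exact IsHomogeneous.sum _ _ _ fun i _ => hp.pderiv.C_mul (x i)

lemma eval_dirDeriv_self (x : Fin n → ℝ) {p : MvPolynomial (Fin n) ℝ} {k : ℕ}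
    (hp : p.IsHomogeneous k) : eval x (dirDeriv x p) = k * eval x p := by
  have := congrArg (eval x) hp.sum_X_mul_pderiv
  rw [dirDeriv_apply]
  simpa using this

lemma fischer_linForm_pow (x : Fin n → ℝ) (k : ℕ) :
    ∀ p : MvPolynomial (Fin n) ℝ, p.IsHomogeneous k →
      fischer k (linForm x ^ k) p = k.factorial * eval x p := by
  induction k with
  | zero =>
    intro p hp
    have hp' : p = C (coeff 0 p) := by
      rw [← totalDegree_eq_zero_iff_eq_C]
      exact Nat.le_zero.1 hp.totalDegree_le
    rw [hp']
    simp [fischer]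
  | succ k ih =>
    intro p hp
    rw [pow_succ', fischer_linForm_mul_left, ih _ (isHomogeneous_dirDeriv x hp),
      eval_dirDeriv_self x hp, Nat.factorial_succ]
    push_cast
    ring

lemma dirDeriv_linForm (x : Fin n → ℝ) : dirDeriv x (linForm x) = C (∑ i, x i ^ 2) := by
  simp only [dirDeriv_apply, linForm, map_sum, pderiv_C_mul, pderiv_X]
  refine Finset.sum_congr rfl fun i _ => ?_
  simp [Pi.single_apply, sq]

lemma pderiv_linForm (x : Fin n → ℝ) (i : Fin n) : pderiv i (linForm x) = C (x i) := by
  simp [linForm, pderiv_X, Pi.single_apply]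

lemma pderiv_normSqForm (i : Fin n) : pderiv i (normSqForm n) = 2 * X i := by
  simp [normSqForm, pderiv_X, Pi.single_apply, Finset.sum_add_distrib, two_mul]

lemma dirDeriv_normSqForm (x : Fin n → ℝ) : dirDeriv x (normSqForm n) = 2 * linForm x := by
  simp only [dirDeriv_apply, pderiv_normSqForm, linForm, Finset.mul_sum]
  exact Finset.sum_congr rfl fun i _ => by ring

lemma laplacian_sub (p q : MvPolynomial (Fin n) ℝ) :
    laplacian (p - q) = laplacian p - laplacian q := by
  simp [laplacian, Finset.sum_sub_distrib]

lemma laplacian_C_mul (a : ℝ) (p : MvPolynomial (Fin n) ℝ) :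
    laplacian (C a * p) = C a * laplacian p := by
  simp [laplacian, Finset.mul_sum]

lemma laplacian_linForm_mul (x : Fin n → ℝ) (p : MvPolynomial (Fin n) ℝ) :
    laplacian (linForm x * p) = 2 * dirDeriv x p + linForm x * laplacian p := by
  simp only [laplacian, dirDeriv_apply, pderiv_mul, pderiv_linForm, map_add, pderiv_C,
    Finset.mul_sum, ← Finset.sum_add_distrib]
  exact Finset.sum_congr rfl fun i _ => by ring

lemma laplacian_normSqForm_mul {p : MvPolynomial (Fin n) ℝ} {k : ℕ} (hp : p.IsHomogeneous k) :
    laplacian (normSqForm n * p) = C (2 * n + 4 * k : ℝ) * p + normSqForm n * laplacian p := by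
  have h := hp.sum_X_mul_pderiv
  have h2 : ∀ i : Fin n, pderiv i (2 : MvPolynomial (Fin n) ℝ) = 0 := fun i => by
    rw [← map_ofNat (C : ℝ →+* MvPolynomial (Fin n) ℝ) 2, pderiv_C]
  have hi : ∀ i : Fin n, pderiv i (pderiv i (normSqForm n * p)) =
      2 * p + 4 * (X i * pderiv i p) + normSqForm n * pderiv i (pderiv i p) := fun i => by
    simp only [pderiv_mul, pderiv_normSqForm, map_add, h2, pderiv_X_self]
    ring
  simp only [laplacian, hi, Finset.sum_add_distrib, ← Finset.mul_sum, h]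
  simp [map_ofNat]
  ring

/-- A monic Gegenbauer recurrence coefficient. -/
noncomputable def gegCoeff (ν : ℝ) (k : ℕ) : ℝ :=
  (k + 1) * (ν + k - 2) / ((ν + 2 * k) * (ν + 2 * k - 2))

/-- The homogenized monic Gegenbauer polynomials for the sphere in dimension `ν`. -/
noncomputable def gegenbauer (ν : ℝ) {R : Type*} [CommRing R] [Algebra ℝ R] (ξ r : R) : ℕ → R
  | 0 => 1
  | 1 => ξ
  | k + 2 => ξ * gegenbauer ν ξ r (k + 1) - algebraMap ℝ R (gegCoeff ν k) * (r * gegenbauer ν ξ r k)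

lemma map_gegenbauer (ν : ℝ) {R S : Type*} [CommRing R] [Algebra ℝ R] [CommRing S] [Algebra ℝ S]
    (f : R →ₐ[ℝ] S) (ξ r : R) (k : ℕ) :
    f (gegenbauer ν ξ r k) = gegenbauer ν (f ξ) (f r) k := by
  induction k using Nat.twoStepInduction with
  | zero => simp [gegenbauer]
  | one => simp [gegenbauer]
  | more k ih ih' => simp [gegenbauer, ih, ih']

/-- The zonal harmonic polynomial of degree `k` with pole `x`. -/
noncomputable def zonal (x : Fin n → ℝ) (k : ℕ) : MvPolynomial (Fin n) ℝ :=
  gegenbauer (n : ℝ) (linForm x) (normSqForm n) k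

lemma zonal_add_two (x : Fin n → ℝ) (k : ℕ) :
    zonal x (k + 2) =
      linForm x * zonal x (k + 1) - C (gegCoeff n k) * (normSqForm n * zonal x k) := rfl

lemma isHomogeneous_zonal (x : Fin n → ℝ) (k : ℕ) : (zonal x k).IsHomogeneous k := by
  induction k using Nat.twoStepInduction with
  | zero => exact isHomogeneous_one _ _
  | one => exact isHomogeneous_linForm x
  | more k ih ih' =>
    rw [zonal_add_two]
    refine IsHomogeneous.sub ?_ ?_
    · have := (isHomogeneous_linForm x).mul ih'
      rwa [show 1 + (k + 1) = k + 2 by ring] at this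
    · have := (isHomogeneous_normSqForm.mul ih).C_mul (gegCoeff n k)
      rwa [show 2 + k = k + 2 by ring] at this

lemma zonal_eq_pow_add (x : Fin n → ℝ) (k : ℕ) :
    ∃ q, zonal x (k + 2) = linForm x ^ (k + 2) + normSqForm n * q := by
  have key : ∀ k, ∃ q, zonal x k = linForm x ^ k + normSqForm n * q := by
    intro k
    induction k using Nat.twoStepInduction with
    | zero => exact ⟨0, by simp [zonal, gegenbauer]⟩
    | one => exact ⟨0, by simp [zonal, gegenbauer]⟩
    | more k ih ih' =>
      obtain ⟨q, hq⟩ := ih'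
      exact ⟨linForm x * q - C (gegCoeff n k) * zonal x k, by rw [zonal_add_two, hq]; ring⟩
  exact key _

/-- The factor in the derivative rule for zonal harmonics. -/
noncomputable def gegDerivCoeff (ν : ℝ) (k : ℕ) : ℝ := (ν + 2 * k) * gegCoeff ν k

lemma gegDerivCoeff_sub {ν : ℝ} (hν : 2 < ν) (k : ℕ) :
    gegDerivCoeff ν k - 2 * gegCoeff ν k = gegDerivCoeff ν (k + 1) - 1 := by
  have h0 : (0 : ℝ) ≤ k := k.cast_nonneg
  have h1 : ν + 2 * k ≠ 0 := by linarith
  have h2 : ν + 2 * k - 2 ≠ 0 := by linarith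
  have h3 : ν + 2 * (k + 1) ≠ 0 := by linarith
  have h4 : ν + 2 * (k + 1) - 2 ≠ 0 := by linarith
  simp only [gegDerivCoeff, gegCoeff]
  push_cast
  rw [show ν + 2 * ((k : ℝ) + 1) - 2 = ν + 2 * k by ring]
  field_simp
  ring

lemma gegCoeff_succ_mul {ν : ℝ} (hν : 2 < ν) (k : ℕ) :
    gegCoeff ν (k + 1) * gegDerivCoeff ν k = (gegDerivCoeff ν (k + 2) - 1) * gegCoeff ν k := by
  have h0 : (0 : ℝ) ≤ k := k.cast_nonneg
  have h1 : ν + 2 * k ≠ 0 := by linarith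
  have h2 : ν + 2 * k - 2 ≠ 0 := by linarith
  have h3 : ν + 2 * (k + 1) ≠ 0 := by linarith
  have h4 : ν + 2 * (k + 2) ≠ 0 := by linarith
  simp only [gegDerivCoeff, gegCoeff]
  push_cast
  rw [show ν + 2 * ((k : ℝ) + 1) - 2 = ν + 2 * k by ring,
    show ν + 2 * ((k : ℝ) + 2) - 2 = ν + 2 * (k + 1) by ring]
  field_simp
  ring

lemma gegDerivCoeff_zero {ν : ℝ} (hν : 2 < ν) : gegDerivCoeff ν 0 = 1 := by
  have h1 : ν ≠ 0 := by linarith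
  have h2 : ν - 2 ≠ 0 := by linarith
  simp only [gegDerivCoeff, gegCoeff]
  push_cast
  simp only [mul_zero, add_zero, zero_add, one_mul]
  field_simp

lemma dirDeriv_zonal (hn : 2 < n) (x : Fin n → ℝ) (hx : ∑ i, x i ^ 2 = 1) (k : ℕ) :
    dirDeriv x (zonal x (k + 1)) = C (gegDerivCoeff n k) * zonal x k := by
  have hν : (2 : ℝ) < n := by exact_mod_cast hn
  have hC : ∀ a : ℝ, dirDeriv x (C a) = 0 := fun a => Derivation.map_algebraMap _ a
  have hξ : dirDeriv x (linForm x) = 1 := by rw [dirDeriv_linForm, hx, C_1]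
  have step : ∀ k, dirDeriv x (zonal x (k + 2)) = zonal x (k + 1) +
      linForm x * dirDeriv x (zonal x (k + 1)) - C (gegCoeff n k) *
        (2 * linForm x * zonal x k + normSqForm n * dirDeriv x (zonal x k)) := by
    intro k
    rw [zonal_add_two, map_sub, Derivation.leibniz, Derivation.leibniz, Derivation.leibniz, hC, hξ,
      dirDeriv_normSqForm]
    simp only [smul_eq_mul]
    ring
  have hA : ∀ k, C (gegDerivCoeff n k) - 2 * C (gegCoeff n k) =
      (C (gegDerivCoeff n (k + 1)) - 1 : MvPolynomial (Fin n) ℝ) := fun k => by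
    have := congrArg (C (σ := Fin n)) (gegDerivCoeff_sub hν k)
    simpa [map_ofNat] using this
  have hB : ∀ k, C (gegCoeff n (k + 1)) * C (gegDerivCoeff n k) =
      (C (gegDerivCoeff n (k + 2)) - 1 : MvPolynomial (Fin n) ℝ) * C (gegCoeff n k) := fun k => by
    have := congrArg (C (σ := Fin n)) (gegCoeff_succ_mul hν k)
    simpa using this
  have h1 : dirDeriv x (zonal x 1) = C (gegDerivCoeff n 0) * zonal x 0 := by
    rw [gegDerivCoeff_zero hν]
    simpa [zonal, gegenbauer] using hξ
  induction k using Nat.twoStepInduction with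
  | zero => exact h1
  | one =>
    have h0 : dirDeriv x (zonal x 0) = 0 := (dirDeriv x).map_one_eq_zero
    have e0 : zonal x 0 = 1 := rfl
    have e1 : zonal x 1 = linForm x := rfl
    have hA0 := hA 0
    rw [gegDerivCoeff_zero hν] at hA0 h1
    rw [step 0, zero_add, h1, h0, e0, e1]
    simp only [C_1, zero_add] at hA0 ⊢
    linear_combination linForm x * hA0
  | more k ih ih' =>
    rw [step (k + 1), show k + 1 + 1 = k + 2 from rfl, ih', ih]
    linear_combination (linForm x * zonal x (k + 1)) * hA (k + 1) -
      normSqForm n * zonal x k * hB k - (C (gegDerivCoeff n (k + 2)) - 1) * zonal_add_two x k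

lemma laplacian_zonal (hn : 2 < n) (x : Fin n → ℝ) (hx : ∑ i, x i ^ 2 = 1) (k : ℕ) :
    laplacian (zonal x k) = 0 := by
  induction k using Nat.twoStepInduction with
  | zero => simp [laplacian, zonal, gegenbauer]
  | one => simp [laplacian, zonal, gegenbauer, pderiv_linForm]
  | more k ih ih' =>
    rw [zonal_add_two, laplacian_sub, laplacian_C_mul, laplacian_linForm_mul,
      laplacian_normSqForm_mul (isHomogeneous_zonal x k), ih, ih', dirDeriv_zonal hn x hx,
      gegDerivCoeff]
    simp only [C_mul, C_add, map_ofNat]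
    ring

lemma eval_zonal (x y : Fin n → ℝ) (hy : ∑ i, y i ^ 2 = 1) (k : ℕ) :
    eval y (zonal x k) = gegenbauer (n : ℝ) (∑ i, x i * y i) 1 k := by
  have h := map_gegenbauer (n : ℝ) (aeval (R := ℝ) y) (linForm x) (normSqForm n) k
  rw [← coe_aeval_eq_eval]
  refine h.trans ?_
  congr 1
  · simp [linForm]
  · simpa [normSqForm, sq] using hy

/-- The reproducing property of zonal harmonics. -/
lemma fischer_zonal (hn : 2 < n) (x y : Fin n → ℝ) (hx : ∑ i, x i ^ 2 = 1)
    (hy : ∑ i, y i ^ 2 = 1) (k : ℕ) :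
    fischer k (zonal x k) (zonal y k) =
      k.factorial * gegenbauer (n : ℝ) (∑ i, x i * y i) 1 k := by
  have hmain := fischer_linForm_pow x k _ (isHomogeneous_zonal y k)
  rw [eval_zonal y x hx, show ∑ i, y i * x i = ∑ i, x i * y i from
    Finset.sum_congr rfl fun _ _ => mul_comm _ _] at hmain
  rw [← hmain]
  match k with
  | 0 => simp [zonal, gegenbauer]
  | 1 => simp [zonal, gegenbauer]
  | k + 2 =>
    obtain ⟨q, hq⟩ := zonal_eq_pow_add x k
    rw [hq, fischer_add_left, fischer_normSqForm_mul_left, laplacian_zonal hn y hy]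
    simp [fischer]

end Fischer

lemma gegenbauer_one_succ {ν : ℝ} (hν : 2 < ν) (k : ℕ) :
    gegenbauer ν (1 : ℝ) 1 (k + 1) =
      (ν + k - 2) / (ν + 2 * k - 2) * gegenbauer ν (1 : ℝ) 1 k := by
  induction k with
  | zero =>
    have : ν - 2 ≠ 0 := by linarith
    simp [gegenbauer, this]
  | succ k ih =>
    have h0 : (0 : ℝ) ≤ k := k.cast_nonneg
    have h1 : ν + 2 * k ≠ 0 := by linarith
    have h2 : ν + 2 * k - 2 ≠ 0 := by linarith
    have : gegenbauer ν (1 : ℝ) 1 (k + 2) = gegenbauer ν (1 : ℝ) 1 (k + 1) -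
      gegCoeff ν k * gegenbauer ν (1 : ℝ) 1 k := by simp [gegenbauer]
    rw [this, ih, gegCoeff]
    push_cast
    rw [show ν + 2 * ((k : ℝ) + 1) - 2 = ν + 2 * k by ring]
    field_simp
    ring

lemma gegenbauer_one_pos {ν : ℝ} (hν : 2 < ν) (k : ℕ) : 0 < gegenbauer ν (1 : ℝ) 1 k := by
  induction k with
  | zero => simp [gegenbauer]
  | succ k ih =>
    rw [gegenbauer_one_succ hν]
    have h0 : (0 : ℝ) ≤ k := k.cast_nonneg
    exact mul_pos (div_pos (by linarith) (by linarith)) ih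

/-- The kernel `K` restricted to `C` is positive semidefinite, with a real factorization through
a space of dimension `D`. -/
def HasFeatures {E : Type*} (C : Finset E) (K : E → E → ℝ) (D : ℕ) : Prop :=
  ∃ (ι : Type) (_ : Fintype ι) (φ : ι → E → ℝ), Fintype.card ι = D ∧
    ∀ x ∈ C, ∀ y ∈ C, K x y = ∑ a, φ a x * φ a y

section HasFeatures

variable {E : Type*} {C : Finset E} {K K' : E → E → ℝ} {D D' : ℕ}

lemma HasFeatures.congr (h : HasFeatures C K D) (hK : ∀ x y, K' x y = K x y) :
    HasFeatures C K' D := by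
  obtain rfl : K' = K := funext₂ hK
  exact h

lemma HasFeatures.zero : HasFeatures C (fun _ _ => 0) 0 :=
  ⟨Empty, inferInstance, fun _ _ => 0, rfl, by simp⟩

lemma HasFeatures.add (h : HasFeatures C K D) (h' : HasFeatures C K' D') :
    HasFeatures C (fun x y => K x y + K' x y) (D + D') := by
  obtain ⟨ι, _, φ, hD, hφ⟩ := h
  obtain ⟨ι', _, φ', hD', hφ'⟩ := h'
  refine ⟨ι ⊕ ι', inferInstance, Sum.elim φ φ', by rw [Fintype.card_sum, hD, hD'], ?_⟩
  intro x hx y hy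
  simp [hφ x hx y hy, hφ' x hx y hy]

lemma HasFeatures.const_mul (h : HasFeatures C K D) {c : ℝ} (hc : 0 ≤ c) :
    HasFeatures C (fun x y => c * K x y) D := by
  obtain ⟨ι, _, φ, hD, hφ⟩ := h
  refine ⟨ι, inferInstance, fun a x => √c * φ a x, hD, ?_⟩
  intro x hx y hy
  beta_reduce
  rw [hφ x hx y hy, Finset.mul_sum]
  refine Finset.sum_congr rfl fun a _ => ?_
  linear_combination (-φ a x * φ a y) * Real.mul_self_sqrt hc

lemma HasFeatures.sum {ι : Type*} (s : Finset ι) {K : ι → E → E → ℝ} {D : ι → ℕ}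
    (h : ∀ i ∈ s, HasFeatures C (K i) (D i)) :
    HasFeatures C (fun x y => ∑ i ∈ s, K i x y) (∑ i ∈ s, D i) := by
  classical
  induction s using Finset.induction_on with
  | empty => simpa using HasFeatures.zero
  | insert a s ha ih =>
    simp only [Finset.sum_insert ha]
    exact (h a (Finset.mem_insert_self a s)).add
      (ih fun i hi => h i (Finset.mem_insert_of_mem hi))

lemma HasFeatures.sum_mul_nonneg (h : HasFeatures C K D) (h' : HasFeatures C K' D') :
    0 ≤ ∑ x ∈ C, ∑ y ∈ C, K x y * K' x y := by
  obtain ⟨ι, _, φ, -, hφ⟩ := h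
  obtain ⟨ι', _, φ', -, hφ'⟩ := h'
  have : ∑ x ∈ C, ∑ y ∈ C, K x y * K' x y =
      ∑ a, ∑ b, (∑ x ∈ C, φ a x * φ' b x) ^ 2 := by
    have e : ∀ x ∈ C, ∀ y ∈ C, K x y * K' x y =
        ∑ a, ∑ b, (φ a x * φ' b x) * (φ a y * φ' b y) := by
      intro x hx y hy
      rw [hφ x hx y hy, hφ' x hx y hy, Finset.sum_mul_sum]
      exact Finset.sum_congr rfl fun _ _ => Finset.sum_congr rfl fun _ _ => by ring
    rw [Finset.sum_congr rfl fun x hx => Finset.sum_congr rfl fun y hy => e x hx y hy]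
    simp only [sq, Finset.sum_mul_sum]
    rw [Finset.sum_congr rfl fun x _ => Finset.sum_comm, Finset.sum_comm]
    refine Finset.sum_congr rfl fun a _ => ?_
    rw [Finset.sum_congr rfl fun x _ => Finset.sum_comm, Finset.sum_comm]
  rw [this]
  positivity

/-- The trace inequality `(tr G)² ≤ rank G · tr G²`. -/
lemma HasFeatures.sq_sum_diag_le (h : HasFeatures C K D) :
    (∑ x ∈ C, K x x) ^ 2 ≤ D * ∑ x ∈ C, ∑ y ∈ C, K x y ^ 2 := by
  obtain ⟨ι, _, φ, rfl, hφ⟩ := h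
  have e1 : ∑ x ∈ C, K x x = ∑ a, ∑ x ∈ C, φ a x * φ a x := by
    rw [Finset.sum_congr rfl fun x hx => hφ x hx x hx, Finset.sum_comm]
  have e2 : ∑ x ∈ C, ∑ y ∈ C, K x y ^ 2 = ∑ a, ∑ b, (∑ x ∈ C, φ a x * φ b x) ^ 2 := by
    have e : ∀ x ∈ C, ∀ y ∈ C, K x y ^ 2 =
        ∑ a, ∑ b, (φ a x * φ b x) * (φ a y * φ b y) := by
      intro x hx y hy
      rw [hφ x hx y hy, sq, Finset.sum_mul_sum]
      exact Finset.sum_congr rfl fun _ _ => Finset.sum_congr rfl fun _ _ => by ring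
    rw [Finset.sum_congr rfl fun x hx => Finset.sum_congr rfl fun y hy => e x hx y hy]
    simp only [sq, Finset.sum_mul_sum]
    rw [Finset.sum_congr rfl fun x _ => Finset.sum_comm, Finset.sum_comm]
    refine Finset.sum_congr rfl fun a _ => ?_
    rw [Finset.sum_congr rfl fun x _ => Finset.sum_comm, Finset.sum_comm]
  rw [e1, e2]
  calc (∑ a, ∑ x ∈ C, φ a x * φ a x) ^ 2
      ≤ Fintype.card ι * ∑ a, (∑ x ∈ C, φ a x * φ a x) ^ 2 := sq_sum_le_card_mul_sum_sq
    _ ≤ _ := by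
      gcongr with a
      exact Finset.single_le_sum (f := fun b => (∑ x ∈ C, φ a x * φ b x) ^ 2)
        (fun _ _ => sq_nonneg _) (Finset.mem_univ a)

end HasFeatures

lemma hasFeatures_gegenbauer {n : ℕ} (hn : 2 < n) {C : Finset (EuclideanSpace ℝ (Fin n))}
    (hC : ∀ x ∈ C, ‖x‖ = 1) (k : ℕ) :
    HasFeatures C (fun x y => gegenbauer (n : ℝ) ⟪x, y⟫ 1 k) (n.multichoose k) := by
  refine ⟨(Finset.univ : Finset (Fin n)).finsuppAntidiag k, inferInstance, fun α x =>
    √(((∏ i, (α.1 i).factorial : ℕ) : ℝ) / k.factorial) * MvPolynomial.coeff α.1 (zonal x.ofLp k),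
    ?_, ?_⟩
  · rw [Fintype.card_coe, Finset.card_finsuppAntidiag_nat_eq_multichoose, Finset.card_univ,
      Fintype.card_fin]
  · intro x hx y hy
    have hsq : ∀ z ∈ C, ∑ i, z.ofLp i ^ 2 = 1 := fun z hz => by
      rw [← EuclideanSpace.real_norm_sq_eq, hC z hz, one_pow]
    have hin : ⟪x, y⟫ = ∑ i, x.ofLp i * y.ofLp i := by
      rw [PiLp.inner_apply]
      exact Finset.sum_congr rfl fun i _ => by simp [mul_comm]
    have hk : (k.factorial : ℝ) ≠ 0 := by positivity
    beta_reduce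
    rw [hin, eq_div_of_mul_eq hk ((mul_comm _ _).trans
      (fischer_zonal hn x.ofLp y.ofLp (hsq x hx) (hsq y hy) k).symm), fischer, Finset.sum_div,
      ← Finset.sum_coe_sort]
    refine Finset.sum_congr rfl fun α _ => ?_
    have := Real.mul_self_sqrt
      (show 0 ≤ ((∏ i, (α.1 i).factorial : ℕ) : ℝ) / k.factorial by positivity)
    linear_combination (-MvPolynomial.coeff α.1 (zonal x.ofLp k) *
      MvPolynomial.coeff α.1 (zonal y.ofLp k)) * this

/-- If `g` and `(u - l) g` are positive semidefinite on `C` for some `l > t`, then `C` is small. -/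
lemma card_le_of_hasFeatures {n D D' : ℕ} {C : Finset (EuclideanSpace ℝ (Fin n))} {t l : ℝ}
    (hC : ∀ x ∈ C, ‖x‖ = 1) (ht : ∀ x ∈ C, ∀ y ∈ C, x ≠ y → ⟪x, y⟫ ≤ t) (ht1 : t ≤ 1) (htl : t < l)
    {g : ℝ → ℝ} (hg1 : 0 < g 1) (hg : HasFeatures C (fun x y => g ⟪x, y⟫) D)
    (hlg : HasFeatures C (fun x y => (⟪x, y⟫ - l) * g ⟪x, y⟫) D') :
    (l - t) * C.card ≤ (1 - t) * D := by
  have hself : ∀ x ∈ C, ⟪x, x⟫ = 1 := fun x hx => by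
    rw [real_inner_self_eq_norm_sq, hC x hx, one_pow]
  rcases C.eq_empty_or_nonempty with rfl | ⟨x₀, hx₀⟩
  · simpa using mul_nonneg (sub_nonneg.2 ht1) D.cast_nonneg
  have hupper : ∑ x ∈ C, ∑ y ∈ C, (⟪x, y⟫ - t) * g ⟪x, y⟫ ^ 2 ≤ C.card * ((1 - t) * g 1 ^ 2) := by
    rw [← nsmul_eq_mul]
    refine Finset.sum_le_card_nsmul _ _ _ fun x hx => ?_
    rw [← Finset.add_sum_erase _ _ hx, hself x hx]
    refine add_le_of_nonpos_right (Finset.sum_nonpos fun y hy => ?_)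
    have := ht x hx y (Finset.mem_of_mem_erase hy) (Finset.ne_of_mem_erase hy).symm
    exact mul_nonpos_of_nonpos_of_nonneg (by linarith) (sq_nonneg _)
  have hprod := hlg.sum_mul_nonneg hg
  have htrace := hg.sq_sum_diag_le
  have hdiag : ∑ x ∈ C, g ⟪x, x⟫ = C.card * g 1 := by
    rw [Finset.sum_congr rfl fun x hx => by rw [hself x hx], Finset.sum_const, nsmul_eq_mul]
  rw [hdiag] at htrace
  have hsplit : ∑ x ∈ C, ∑ y ∈ C, (⟪x, y⟫ - t) * g ⟪x, y⟫ ^ 2 =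
      (∑ x ∈ C, ∑ y ∈ C, (⟪x, y⟫ - l) * g ⟪x, y⟫ * g ⟪x, y⟫) +
        (l - t) * ∑ x ∈ C, ∑ y ∈ C, g ⟪x, y⟫ ^ 2 := by
    simp only [Finset.mul_sum, ← Finset.sum_add_distrib]
    exact Finset.sum_congr rfl fun _ _ => Finset.sum_congr rfl fun _ _ => by ring
  set S := ∑ x ∈ C, ∑ y ∈ C, g ⟪x, y⟫ ^ 2
  have hcard : (0 : ℝ) < C.card := by exact_mod_cast Finset.card_pos.2 ⟨x₀, hx₀⟩
  have h1 : (l - t) * S ≤ C.card * ((1 - t) * g 1 ^ 2) := by linarith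
  have h2 : (l - t) * (C.card * g 1) ^ 2 ≤ D * (C.card * ((1 - t) * g 1 ^ 2)) :=
    calc (l - t) * (C.card * g 1) ^ 2 ≤ (l - t) * (D * S) :=
          mul_le_mul_of_nonneg_left htrace (by linarith)
      _ = D * ((l - t) * S) := by ring
      _ ≤ _ := by gcongr
  refine le_of_mul_le_mul_right (a := C.card * g 1 ^ 2) ?_ (by positivity)
  linarith [h2]

lemma sum_recurrence_eq (d b q : ℕ → ℝ) (u l : ℝ)
    (hq : ∀ j, u * q (j + 1) = q (j + 2) + b j * q j) (N : ℕ) :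
    (u - l) * ∑ j ∈ Finset.range N, d (j + 1) * q (j + 1) =
      d N * q (N + 1) - d 0 * q 1 + (d 1 * b 0 * q 0 - d (N + 1) * b N * q N) +
        ∑ j ∈ Finset.range N, (d j + b (j + 1) * d (j + 2) - l * d (j + 1)) * q (j + 1) := by
  induction N with
  | zero => simp
  | succ N ih =>
    rw [Finset.sum_range_succ, Finset.sum_range_succ, mul_add, ih]
    linear_combination d (N + 1) * hq N

/-- A window of `N` consecutive Gegenbauer polynomials bounds the size of a code. -/
lemma card_le_of_gegCoeff {n : ℕ} (hn : 2 < n) {C : Finset (EuclideanSpace ℝ (Fin n))} {t r : ℝ}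
    (hC : ∀ x ∈ C, ‖x‖ = 1) (ht : ∀ x ∈ C, ∀ y ∈ C, x ≠ y → ⟪x, y⟫ ≤ t) (ht1 : t ≤ 1)
    (hr : 0 < r) {M N : ℕ} (hN : 0 < N) (hM : ∀ k, M ≤ k → r ^ 2 ≤ gegCoeff n k)
    (htr : t < 2 * r * Real.cos (Real.pi / (N + 1))) :
    (2 * r * Real.cos (Real.pi / (N + 1)) - t) * C.card ≤
      (1 - t) * (∑ j ∈ Finset.range N, n.multichoose (M + j + 1) : ℕ) := by
  have hν : (2 : ℝ) < n := by exact_mod_cast hn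
  set θ := Real.pi / (N + 1) with hθ
  have hθN : ((N + 1 : ℕ) : ℝ) * θ = Real.pi := by
    rw [hθ]; push_cast; field_simp
  have hθ0 : 0 < θ := by positivity
  set d : ℕ → ℝ := fun j => (r ^ j)⁻¹ * Real.sin (j * θ) with hd
  have hd_le : ∀ j ≤ N + 1, (j : ℝ) * θ ≤ Real.pi := fun j hj => by
    rw [← hθN]; gcongr
  have hd_nonneg : ∀ j ≤ N + 1, 0 ≤ d j := fun j hj =>
    mul_nonneg (by positivity) (Real.sin_nonneg_of_nonneg_of_le_pi (by positivity) (hd_le j hj))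
  have hd_pos : ∀ j < N, 0 < d (j + 1) := fun j hj => by
    refine mul_pos (by positivity) (Real.sin_pos_of_pos_of_lt_pi (by positivity) ?_)
    rw [← hθN]
    have : j + 1 < N + 1 := by omega
    gcongr
  have hd0 : d 0 = 0 := by simp [hd]
  have hdN : d (N + 1) = 0 := by simp only [hd, hθN, Real.sin_pi, mul_zero]
  have hd_rec : ∀ j, d j + r ^ 2 * d (j + 2) = 2 * r * Real.cos θ * d (j + 1) := fun j => by
    have h1 : Real.sin ((j : ℕ) * θ) = Real.sin (((j + 1 : ℕ) : ℝ) * θ - θ) := by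
      push_cast; ring_nf
    have h2 : Real.sin (((j + 2 : ℕ) : ℝ) * θ) = Real.sin (((j + 1 : ℕ) : ℝ) * θ + θ) := by
      push_cast; ring_nf
    simp only [hd]
    rw [h1, h2, Real.sin_sub, Real.sin_add]
    field_simp
    ring
  set q : ℕ → ℝ → ℝ := fun j u => gegenbauer (n : ℝ) u 1 (M + j) with hq
  set g : ℝ → ℝ := fun u => ∑ j ∈ Finset.range N, d (j + 1) * q (j + 1) u with hg
  have hfeat : ∀ k, HasFeatures C (fun x y => q k ⟪x, y⟫) (n.multichoose (M + k)) := fun k =>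
    hasFeatures_gegenbauer hn hC _
  have hb : ∀ k, 0 ≤ gegCoeff n (M + k) := fun k =>
    (sq_nonneg r).trans (hM _ (Nat.le_add_right _ _))
  have hg1 : 0 < g 1 := Finset.sum_pos
    (fun j hj => mul_pos (hd_pos j (Finset.mem_range.1 hj)) (gegenbauer_one_pos hν _))
    (Finset.nonempty_range_iff.2 hN.ne')
  have hgf : HasFeatures C (fun x y => g ⟪x, y⟫)
      (∑ j ∈ Finset.range N, n.multichoose (M + j + 1)) :=
    HasFeatures.sum _ fun j hj =>
      (hfeat (j + 1)).const_mul (hd_pos j (Finset.mem_range.1 hj)).le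
  have hlgf := (((hfeat (N + 1)).const_mul (hd_nonneg N N.le_succ)).add
    ((hfeat 0).const_mul (mul_nonneg (hd_nonneg 1 (by omega)) (hb 0)))).add
    (HasFeatures.sum (Finset.range N) fun j hj => (hfeat (j + 1)).const_mul
      (c := d j + gegCoeff n (M + (j + 1)) * d (j + 2) - 2 * r * Real.cos θ * d (j + 1)) (by
        have hj' := Finset.mem_range.1 hj
        have := mul_le_mul_of_nonneg_right (hM (M + (j + 1)) (Nat.le_add_right _ _))
          (hd_nonneg (j + 2) (by omega))
        linarith [hd_rec j]))
  refine card_le_of_hasFeatures hC ht ht1 htr hg1 hgf (hlgf.congr fun x y => ?_)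
  have := sum_recurrence_eq d (fun j => gegCoeff n (M + j)) (fun j => q j ⟪x, y⟫) ⟪x, y⟫
    (2 * r * Real.cos θ) (fun j => ?_) N
  · rw [hd0, hdN] at this
    rw [hg]
    linear_combination this
  · simp only [hq]
    have : gegenbauer (n : ℝ) (⟪x, y⟫ : ℝ) 1 (M + j + 2) = ⟪x, y⟫ * gegenbauer (n : ℝ) ⟪x, y⟫ 1
      (M + j + 1) - gegCoeff n (M + j) * (1 * gegenbauer (n : ℝ) ⟪x, y⟫ 1 (M + j)) := rfl
    rw [← add_assoc, ← add_assoc, this]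
    ring

lemma multichoose_le_pow_mul_pow (n k : ℕ) {a : ℝ} (ha : 0 < a) :
    (n.multichoose k : ℝ) ≤ ((1 + a) / a) ^ k * (1 + a) ^ n := by
  have h1 : n.multichoose k ≤ (n + k).choose k := by
    rw [Nat.multichoose_eq]
    exact Nat.choose_le_choose k (Nat.sub_le _ _)
  have h2 : a ^ k * (n + k).choose k ≤ (1 + a) ^ (n + k) := by
    rw [add_comm 1 a, add_pow]
    have := Finset.single_le_sum (f := fun m => a ^ m * 1 ^ (n + k - m) * ((n + k).choose m : ℝ))
      (s := Finset.range (n + k + 1)) (fun _ _ => by positivity)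
      (Finset.mem_range.2 (by omega : k < n + k + 1))
    simpa using this
  calc (n.multichoose k : ℝ) ≤ (n + k).choose k := by exact_mod_cast h1
    _ ≤ (1 + a) ^ (n + k) / a ^ k := by rwa [le_div_iff₀' (by positivity)]
    _ = _ := by rw [div_pow, pow_add]; ring

lemma le_gegCoeff {n : ℕ} (hn : 2 < n) {a : ℝ} (ha : 0 < a) {k : ℕ} (hk : a * n + 1 ≤ k) :
    (1 - 1 / (1 + 2 * a) ^ 2) / 4 ≤ gegCoeff n k := by
  have hν : (3 : ℝ) ≤ n := by exact_mod_cast hn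
  have hk0 : (0 : ℝ) ≤ k := k.cast_nonneg
  have hW : (1 + 2 * a) * n ≤ n + 2 * k - 1 := by linarith
  have hW2 : (n : ℝ) ^ 2 ≤ (n + 2 * k - 1) ^ 2 * (1 / (1 + 2 * a) ^ 2) := by
    rw [mul_one_div, le_div_iff₀ (by positivity), ← mul_pow]
    exact pow_le_pow_left₀ (by positivity) (by linarith) 2
  have h1 : 1 / (1 + 2 * a) ^ 2 ≤ 1 := by
    rw [div_le_one (by positivity)]
    nlinarith
  have hpos : (0 : ℝ) < (n + 2 * k) * (n + 2 * k - 2) :=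
    mul_pos (by linarith) (by linarith)
  rw [gegCoeff, div_le_div_iff₀ (by norm_num) hpos]
  nlinarith

/-- The exponential growth rate, in nats, of the number of monomials of degree `a n` in `n`
variables. -/
noncomputable def growthRate (a : ℝ) : ℝ := (1 + a) * Real.log (1 + a) - a * Real.log a

lemma growthRate_nonneg {a : ℝ} (ha : 0 < a) : 0 ≤ growthRate a := by
  have h1 : 0 ≤ Real.log (1 + a) := Real.log_nonneg (by linarith)
  have h2 : Real.log a ≤ Real.log (1 + a) := Real.log_le_log ha (by linarith)
  unfold growthRate
  nlinarith

/-- Codes with `⟨x, y⟩ ≤ t` have size at most `K * exp (n * growthRate a)` as soon as `t` is below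
the limiting largest Gegenbauer root `√(1 - 1 / (1 + 2 a)²)`. -/
lemma exists_log_card_le {t a : ℝ} (ht0 : 0 < t) (ht1 : t < 1) (ha : 0 < a)
    (hta : t < √(1 - 1 / (1 + 2 * a) ^ 2)) :
    ∃ K : ℝ, ∀ n : ℕ, 2 < n → ∀ C : Finset (EuclideanSpace ℝ (Fin n)), C.Nonempty →
      (∀ x ∈ C, ‖x‖ = 1) → (∀ x ∈ C, ∀ y ∈ C, x ≠ y → ⟪x, y⟫ ≤ t) →
      Real.log C.card ≤ n * growthRate a + K := by
  set τ := √(1 - 1 / (1 + 2 * a) ^ 2) with hτ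
  have hτ0 : 0 < τ := ht0.trans hta
  obtain ⟨N, hN0, hN⟩ : ∃ N : ℕ, 0 < N ∧ t < 2 * (τ / 2) * Real.cos (Real.pi / (N + 1)) := by
    have h1 : Filter.Tendsto (fun N : ℕ => Real.pi / ((N : ℝ) + 1)) Filter.atTop (nhds 0) :=
      tendsto_const_nhds.div_atTop
        (Filter.tendsto_atTop_add_const_right _ _ tendsto_natCast_atTop_atTop)
    have h2 : Filter.Tendsto (fun N : ℕ => 2 * (τ / 2) * Real.cos (Real.pi / ((N : ℝ) + 1)))
        Filter.atTop (nhds (2 * (τ / 2) * Real.cos 0)) :=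
      ((Real.continuous_cos.tendsto 0).comp h1).const_mul _
    have h3 : t < 2 * (τ / 2) * Real.cos 0 := by rw [Real.cos_zero]; linarith
    exact ((Filter.eventually_gt_atTop 0).and (h2.eventually_const_lt h3)).exists
  set l := 2 * (τ / 2) * Real.cos (Real.pi / (N + 1)) with hl
  have hlt : 0 < l - t := sub_pos.2 hN
  have ht1' : 0 < 1 - t := sub_pos.2 ht1
  have hP1 : 1 ≤ (1 + a) / a := by rw [le_div_iff₀ ha]; linarith
  have hlogP : Real.log ((1 + a) / a) = Real.log (1 + a) - Real.log a :=
    Real.log_div (by positivity) ha.ne'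
  refine ⟨Real.log ((1 - t) * N / (l - t)) + (N + 2) * Real.log ((1 + a) / a), ?_⟩
  intro n hn C hCne hC ht
  set M := ⌈a * n⌉₊ + 1 with hM
  have hM1 : a * n + 1 ≤ M := by
    rw [hM]; push_cast; linarith [Nat.le_ceil (a * n)]
  have hM2 : (M : ℝ) ≤ a * n + 2 := by
    rw [hM]; push_cast; linarith [Nat.ceil_lt_add_one (show 0 ≤ a * n by positivity)]
  have hcoeff : ∀ k, M ≤ k → (τ / 2) ^ 2 ≤ gegCoeff n k := fun k hk => by
    have := le_gegCoeff hn ha (hM1.trans (Nat.cast_le.2 hk))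
    rwa [div_pow, hτ, Real.sq_sqrt (Real.sqrt_pos.1 hτ0).le, show (2 : ℝ) ^ 2 = 4 by norm_num]
  have hcard := card_le_of_gegCoeff hn hC ht ht1.le (by positivity) hN0 hcoeff hN
  have hdim : ((∑ j ∈ Finset.range N, n.multichoose (M + j + 1) : ℕ) : ℝ) ≤
      N * (((1 + a) / a) ^ (M + N) * (1 + a) ^ n) := by
    push_cast
    calc _ ≤ ∑ _j ∈ Finset.range N, ((1 + a) / a) ^ (M + N) * (1 + a) ^ n := by
          refine Finset.sum_le_sum fun j hj => (multichoose_le_pow_mul_pow n _ ha).trans ?_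
          have : M + j + 1 ≤ M + N := by have := Finset.mem_range.1 hj; omega
          gcongr
      _ = _ := by simp
  have hCpos : (0 : ℝ) < C.card := by exact_mod_cast hCne.card_pos
  have hNpos : (0 : ℝ) < N := by exact_mod_cast hN0
  have hfinal : (C.card : ℝ) ≤
      (1 - t) * N / (l - t) * (((1 + a) / a) ^ (M + N) * (1 + a) ^ n) := by
    rw [div_mul_eq_mul_div, le_div_iff₀' hlt, mul_assoc (1 - t)]
    exact hcard.trans (mul_le_mul_of_nonneg_left hdim ht1'.le)
  have hlog := Real.log_le_log hCpos hfinal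
  rw [Real.log_mul (by positivity) (by positivity), Real.log_mul (by positivity) (by positivity),
    Real.log_pow, Real.log_pow] at hlog
  have hmul : ((M + N : ℕ) : ℝ) * Real.log ((1 + a) / a) ≤
      (a * n + 2 + N) * Real.log ((1 + a) / a) := by
    refine mul_le_mul_of_nonneg_right ?_ (Real.log_nonneg hP1)
    push_cast
    linarith
  rw [growthRate]
  rw [hlogP] at *
  linarith

/-- The asymptotic Kabatiansky–Levenshtein bound for codes in the real projective
space `ℙℝ^{n-1}`. -/
theorem kl_bound_projective (t : ℝ) (ht0 : 0 < t) (ht1 : t < 1)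
    (s : ℝ) (hs : s = (1 / Real.sqrt (1 - t ^ 2) - 1) / 2)
    (ε : ℝ) (hε : 0 < ε) :
    ∃ N : ℕ, ∀ n : ℕ, N ≤ n → ∀ C : Finset (EuclideanSpace ℝ (Fin n)),
      (∀ x ∈ C, ‖x‖ = 1) →
      (∀ x ∈ C, ∀ y ∈ C, x ≠ y → |⟪x, y⟫| ≤ t) →
      (1 / (n : ℝ)) * Real.logb 2 C.card
        ≤ (1 + s) * Real.logb 2 (1 + s) - s * Real.logb 2 s + ε := by
  have ht2 : 0 < 1 - t ^ 2 := by nlinarith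
  have hw0 : 0 < √(1 - t ^ 2) := Real.sqrt_pos.2 ht2
  have hw1 : √(1 - t ^ 2) < 1 := by
    rw [Real.sqrt_lt' one_pos]; nlinarith
  have hs1 : 1 + 2 * s = 1 / √(1 - t ^ 2) := by rw [hs]; ring
  have hs0 : 0 < s := by
    have := (one_lt_div hw0).2 hw1
    linarith
  have hlog2 : 0 < Real.log 2 := Real.log_pos one_lt_two
  have hcont : ContinuousAt growthRate s := by
    have h1 : (1 + s) ≠ 0 := by positivity
    have h2 : s ≠ 0 := hs0.ne'
    unfold growthRate
    fun_prop (disch := assumption)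
  have hev := hcont.tendsto.eventually_lt_const
    (show growthRate s < growthRate s + ε * Real.log 2 / 2 by linarith [mul_pos hε hlog2])
  obtain ⟨a, hae, has⟩ := ((hev.filter_mono nhdsWithin_le_nhds).and
    (self_mem_nhdsWithin (a := s) (s := Set.Ioi s))).exists
  have has : s < a := has
  have hta : t < √(1 - 1 / (1 + 2 * a) ^ 2) := by
    rw [Real.lt_sqrt ht0.le]
    have h1 : 1 / (1 + 2 * a) ^ 2 < 1 / (1 + 2 * s) ^ 2 := by gcongr
    rw [hs1, div_pow, one_pow, one_div_one_div, Real.sq_sqrt ht2.le] at h1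
    linarith
  obtain ⟨K, hK⟩ := exists_log_card_le ht0 ht1 (hs0.trans has) hta
  refine ⟨max 3 ⌈K / (ε * Real.log 2 / 2)⌉₊, fun n hn C hC ht => ?_⟩
  have hn3 : 2 < n := (le_max_left _ _).trans hn
  have hn0 : (0 : ℝ) < n := by positivity
  have hnK : K ≤ n * (ε * Real.log 2 / 2) := by
    rw [← div_le_iff₀ (by positivity)]
    exact (Nat.le_ceil _).trans (Nat.cast_le.2 ((le_max_right _ _).trans hn))
  have hlog : Real.log C.card ≤ n * (growthRate s + ε * Real.log 2) := by
    rcases C.eq_empty_or_nonempty with rfl | hne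
    · have := growthRate_nonneg hs0
      simp only [Finset.card_empty, Nat.cast_zero, Real.log_zero]
      positivity
    · have := hK n hn3 C hne hC fun x hx y hy hxy => (le_abs_self _).trans (ht x hx y hy hxy)
      nlinarith [mul_le_mul_of_nonneg_left hae.le hn0.le]
  have hrhs : (1 + s) * Real.logb 2 (1 + s) - s * Real.logb 2 s + ε =
      (growthRate s + ε * Real.log 2) / Real.log 2 := by
    simp only [Real.logb, growthRate]
    field_simp
  rw [hrhs, Real.logb, one_div_mul_eq_div, div_div, div_le_div_iff₀ (by positivity) hlog2]
  nlinarith [mul_le_mul_of_nonneg_right hlog hlog2.le]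
end
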